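/- Path formula for Pieri coefficients: assume axiom (C0): there exists a regular dominant ρ' ∈ V₀ such that for every λ ∈ Λ₊ there is a unique p ∈ P^W of degree ℓ(λ) with p(ρ'+μ) = δ_{λμ} for all μ ∈ Λ₊ with ℓ(μ) ≤ ℓ(λ). Let ρ ∈ V₀ be regular dominant, h ∈ P^W, τ ∈ Λ with d := ℓ(τ), and μ ∈ Λ₊ with μ+τ ∈ Λ₊. Then a_τ^h(μ) = Σ_{τ*} [Σ_{i=0}^d ((−1)^{d−i}/(i!(d−i)!))·h(ρ+τ_i)]·f_{τ₁−τ₀}(ρ+τ₁)⋯f_{τ_d−τ_{d−1}}(ρ+τ_d), where the outer sum runs over all positive paths τ* = (τ₀, …, τ_d) from μ to μ+τ. -/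

import Mathlib

/-
Common framework for F. Knop, "Construction of Commuting Difference Operators
for Multiplicity Free Spaces".

We identify `Γ` with `ι → ℤ` via its basis `Σ` (so `Σ` is the standard basis),
`Γ^∨` with `ι → ℤ` via the dual basis `Σ^∨`, and `V = Hom(Γ, ℂ)` with `ι → ℂ`.
-/

open scoped BigOperators Classical
open MvPolynomial

noncomputable section

namespace Knop

variable {ι : Type*} [Fintype ι] [DecidableEq ι]

/-- The `i`-th element of the basis `Σ` of `Γ` (resp. of `Σ^∨ ⊆ Γ^∨`), in coordinates. -/
def e (i : ι) : ι → ℤ := Pi.single i 1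

/-- The pairing between `Γ` and `Γ^∨` (in coordinates, the dot product);
`pairZ γ η = γ(η) = η(γ)`. -/
def pairZ (γ η : ι → ℤ) : ℤ := ∑ i, γ i * η i

/-- Evaluation of `γ ∈ Γ` as a linear function on `V = Hom(Γ,ℂ) ≅ ι → ℂ`. -/
def evalC (γ : ι → ℤ) (z : ι → ℂ) : ℂ := ∑ i, (γ i : ℂ) * z i

/-- The embedding `Γ^∨ ⊆ V`. -/
def toV (η : ι → ℤ) : ι → ℂ := fun i => (η i : ℂ)

/-- The action of `w ∈ Aut(Γ)` on `V = Hom(Γ, ℂ)`: `(w • z)(γ) = z(w⁻¹ γ)`, in coordinates. -/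
def actV (w : (ι → ℤ) ≃ₗ[ℤ] (ι → ℤ)) (z : ι → ℂ) : ι → ℂ :=
  fun i => evalC (w.symm (e i)) z

/-- The action of `w ∈ Aut(Γ)` on `Γ^∨ = Hom(Γ, ℤ)`: `(w • η)(γ) = η(w⁻¹ γ)`. -/
def actDual (w : (ι → ℤ) ≃ₗ[ℤ] (ι → ℤ)) (η : ι → ℤ) : ι → ℤ :=
  fun i => pairZ (w.symm (e i)) η

/-- `Λ₊`, the `ℕ`-span of `Σ^∨` inside `Γ^∨`. -/
def LamPlus : Set (ι → ℤ) := {η | ∀ i, 0 ≤ η i}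

/-- The reflection `s_α(x) = x - α^∨(x)·α` attached to a root `α` with coroot `αv`. -/
def reflMap (α αv : ι → ℤ) : (ι → ℤ) → (ι → ℤ) := fun x => x - pairZ x αv • α

/-- The data `(Γ, Σ, W, ℓ)` together with the axioms C1–C8 of Knop's paper
(in the coordinates given by `Σ`).  The root system `Δ` of `W`, the set
`Φ = W·Σ`, and `Λ₁ = W·Σ^∨₁` are carried along as `Finset`s with their
defining specifications. -/
structure Data (ι : Type*) [Fintype ι] [DecidableEq ι] where
  /-- the reflection group `W ⊆ Aut(Γ)` -/
  W : Subgroup ((ι → ℤ) ≃ₗ[ℤ] (ι → ℤ))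
  /-- `W` is finite -/
  W_finite : (W : Set ((ι → ℤ) ≃ₗ[ℤ] (ι → ℤ))).Finite
  /-- the element `ℓ ∈ Γ` -/
  ell : ι → ℤ
  /-- the set of roots `Δ ⊆ Γ` of `W` -/
  Δ : Finset (ι → ℤ)
  /-- the coroot `α^∨ ∈ Γ^∨` of a root `α` -/
  coroot : (ι → ℤ) → (ι → ℤ)
  /-- `Φ = W·Σ` -/
  Φ : Finset (ι → ℤ)
  /-- `Λ₁ = W·Σ^∨₁` -/
  Λ₁ : Finset (ι → ℤ)
  Φ_spec : ∀ ω, ω ∈ Φ ↔ ∃ w ∈ W, ∃ i, ω = w (e i)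
  Λ₁_spec : ∀ η, η ∈ Λ₁ ↔ ∃ w ∈ W, ∃ i, ell i = 1 ∧ η = actDual w (e i)
  /-- `Δ = -Δ` -/
  Δ_neg : ∀ α ∈ Δ, -α ∈ Δ
  /-- every root is a primitive vector of `Γ` -/
  Δ_prim : ∀ α ∈ Δ, ∀ (n : ℤ) (β : ι → ℤ), α = n • β → IsUnit n
  /-- the reflection `s_α` belongs to `W` -/
  refl_mem : ∀ α ∈ Δ, ∃ w ∈ W, ∀ x, w x = reflMap α (coroot α) x
  /-- `α^∨(α) = 2` -/
  coroot_pair : ∀ α ∈ Δ, pairZ α (coroot α) = 2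
  /-- C1: `W` is generated by the reflections `s_α`, `α ∈ Δ` -/
  C1 : W ≤ Subgroup.closure {w : (ι → ℤ) ≃ₗ[ℤ] (ι → ℤ) |
        ∃ α ∈ Δ, ∀ x, w x = reflMap α (coroot α) x}
  /-- C2: `Δ = Δ⁺ ∪ (-Δ⁺)` -/
  C2 : ∀ α ∈ Δ, (∀ i, 0 ≤ α i) ∨ (∀ i, α i ≤ 0)
  /-- C3: `Φ ⊆ Φ⁺ ∪ (-Φ⁺)` -/
  C3 : ∀ ω ∈ Φ, (∀ i, 0 ≤ ω i) ∨ (∀ i, ω i ≤ 0)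
  /-- C4: `ℓ ∈ Γ^W` -/
  C4 : ∀ w ∈ W, w ell = ell
  /-- C5: `Σ_{ω ∈ Φ⁺} ω - Σ_{α ∈ Δ⁺} α = ℓ` -/
  C5 : (∑ ω ∈ Φ.filter (fun ω => ∀ i, 0 ≤ ω i), ω)
        - (∑ α ∈ Δ.filter (fun α => ∀ i, 0 ≤ α i), α) = ell
  /-- C6: `ℓ(η) > 0` for all `η ∈ Σ^∨` -/
  C6 : ∀ i, 0 < ell i
  /-- C7: `ω(η) ∈ {-1,0,1}` for `η ∈ Σ^∨₁` and `ω ∈ Δ ∪ Φ` -/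
  C7 : ∀ i, ell i = 1 → ∀ ω, (ω ∈ Δ ∨ ω ∈ Φ) → ω i = -1 ∨ ω i = 0 ∨ ω i = 1
  /-- C8: a `W`-invariant linear function on `V` is determined by its restriction to `Σ^∨₁` -/
  C8 : ∀ c c' : ι → ℂ,
    (∀ w ∈ W, ∀ z : ι → ℂ, ∑ i, c i * actV w z i = ∑ i, c i * z i) →
    (∀ w ∈ W, ∀ z : ι → ℂ, ∑ i, c' i * actV w z i = ∑ i, c' i * z i) →
    (∀ i, ell i = 1 → c i = c' i) → c = c'

namespace Data

variable (D : Data ι)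

/-- `Δ⁺`, the positive roots. -/
def Δpos : Finset (ι → ℤ) := D.Δ.filter fun α => ∀ i, 0 ≤ α i

/-- `Φ⁺`. -/
def Φpos : Finset (ι → ℤ) := D.Φ.filter fun ω => ∀ i, 0 ≤ ω i

/-- The submonoid `Λ` of `Γ^∨` generated by `Λ₁`. -/
def Lam : AddSubmonoid (ι → ℤ) := AddSubmonoid.closure (D.Λ₁ : Set (ι → ℤ))

/-- `ρ ∈ V₀`: `ω₁(ρ) = ω₂(ρ)` whenever `ω₁, ω₂ ∈ Σ` lie in the same `±W`-orbit. -/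
def InV0 (ρ : ι → ℂ) : Prop :=
  ∀ i j : ι, (∃ w ∈ D.W, e i = w (e j) ∨ e i = -(w (e j))) → ρ i = ρ j

/-- `k` is the multiplicity-parameter function of `ρ ∈ V₀`:
`k_ω = ω₁(ρ)` for any `ω₁ ∈ (±W)·ω ∩ Σ`. -/
def IsK (ρ : ι → ℂ) (k : (ι → ℤ) → ℂ) : Prop :=
  ∀ (ω : ι → ℤ) (i : ι), (∃ w ∈ D.W, e i = w ω ∨ e i = -(w ω)) → k ω = ρ i

/-- `ρ` is dominant: `α(ρ) ∉ {-1,-2,…}` for all `α ∈ Δ⁺`. -/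
def Dominant (ρ : ι → ℂ) : Prop :=
  ∀ α ∈ D.Δpos, ∀ n : ℕ, evalC α ρ ≠ -((n : ℂ) + 1)

/-- `ρ` is regular: `α(ρ) ≠ 0` for all `α ∈ Δ⁺`. -/
def Regular (ρ : ι → ℂ) : Prop :=
  ∀ α ∈ D.Δpos, evalC α ρ ≠ 0

/-- `ρ` is non-integral: `α(ρ) ∉ ℤ` for all `α ∈ Δ`. -/
def NonIntegral (ρ : ι → ℂ) : Prop :=
  ∀ α ∈ D.Δ, ∀ n : ℤ, evalC α ρ ≠ (n : ℂ)

/-- `ρ` is strongly dominant (`k` being the parameter function of `ρ`). -/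
def StronglyDominant (ρ : ι → ℂ) (k : (ι → ℤ) → ℂ) : Prop :=
  D.Regular ρ ∧ D.Dominant ρ ∧
    ∀ ω ∈ D.Φpos, (∀ n : ℕ, evalC ω ρ - k ω ≠ -((n : ℂ) + 1)) ∧
      (∀ n : ℕ, evalC ω ρ + k ω ≠ -(n : ℂ))

/-- The rational function `f_η`, `η ∈ Λ₁`. -/
def f (k : (ι → ℤ) → ℂ) (η : ι → ℤ) (z : ι → ℂ) : ℂ :=
  (∏ ω ∈ D.Φ.filter (fun ω => 0 < pairZ ω η), (evalC ω z - k ω)) /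
  (∏ α ∈ D.Δ.filter (fun α => 0 < pairZ α η), evalC α z)

/-- The value at `z` of `L(p) = Σ_{η ∈ Λ₁} f_η T_η (p)`. -/
def Lval (k : (ι → ℤ) → ℂ) (p : MvPolynomial ι ℂ) (z : ι → ℂ) : ℂ :=
  ∑ η ∈ D.Λ₁, D.f k η z * eval (z - toV η) p

/-- `W`-invariance of a polynomial function on `V`. -/
def WInv (p : MvPolynomial ι ℂ) : Prop :=
  ∀ w ∈ D.W, ∀ z : ι → ℂ, eval (actV w z) p = eval z p

/-- The defining property of the Capelli polynomial `p_λ` (with shift `ρ`):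
`p` is `W`-invariant of degree `≤ ℓ(λ)` and `p(ρ+μ) = δ_{λμ}` for all
`μ ∈ Λ₊` with `ℓ(μ) ≤ ℓ(λ)`. -/
def CapelliAt (ρ : ι → ℂ) (lam : ι → ℤ) (p : MvPolynomial ι ℂ) : Prop :=
  D.WInv p ∧ (p.totalDegree : ℤ) ≤ pairZ D.ell lam ∧
    ∀ μ : ι → ℤ, μ ∈ LamPlus → pairZ D.ell μ ≤ pairZ D.ell lam →
      eval (ρ + toV μ) p = if μ = lam then 1 else 0

/-- Axiom C0: for some regular dominant `ρ' ∈ V₀` and every `λ ∈ Λ₊` there is a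
unique `W`-invariant polynomial of degree `ℓ(λ)` with `p(ρ'+μ) = δ_{λμ}` for all
`μ ∈ Λ₊` with `ℓ(μ) ≤ ℓ(λ)`. -/
def C0 : Prop :=
  ∃ ρ' : ι → ℂ, D.InV0 ρ' ∧ D.Regular ρ' ∧ D.Dominant ρ' ∧
    ∀ lam : ι → ℤ, lam ∈ LamPlus →
      ∃! p : MvPolynomial ι ℂ, D.WInv p ∧
        p.totalDegree = (pairZ D.ell lam).toNat ∧
        ∀ μ : ι → ℤ, μ ∈ LamPlus → pairZ D.ell μ ≤ pairZ D.ell lam →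
          eval (ρ' + toV μ) p = if μ = lam then 1 else 0

end Data

/-- The `m`-th point `τ_m` of the path starting at `lam` with step sequence `s`
(steps are meant to lie in `Λ₁`). -/
def pathPt (lam : ι → ℤ) {d : ℕ} (s : Fin d → ι → ℤ) (m : ℕ) : ι → ℤ :=
  lam + ∑ i ∈ Finset.univ.filter (fun i : Fin d => (i : ℕ) < m), s i

/-- All paths of length `d` from `lam` to `mu` (with steps in `Λ₁`), encoded by
their step sequences. -/
def paths (D : Data ι) (lam mu : ι → ℤ) (d : ℕ) : Finset (Fin d → ι → ℤ) :=
  (Fintype.piFinset fun _ : Fin d => D.Λ₁).filter fun s => pathPt lam s d = mu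

/-- All positive paths of length `d` from `lam` to `mu`. -/
def posPaths (D : Data ι) (lam mu : ι → ℤ) (d : ℕ) : Finset (Fin d → ι → ℤ) :=
  (Fintype.piFinset fun _ : Fin d => D.Λ₁).filter fun s =>
    (∀ m ≤ d, pathPt lam s m ∈ LamPlus) ∧ pathPt lam s d = mu

/-- The falling factorial `[x ↓ d] = x(x-1)⋯(x-d+1)`. -/
def ffall (x : ℂ) (d : ℤ) : ℂ := ∏ j ∈ Finset.range d.toNat, (x - (j : ℂ))

namespace Data

variable (D : Data ι)

/-- The generalized rational function `f_τ`, `τ ∈ Λ` (formula (Def-f-l)). -/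
def fgen (k : (ι → ℤ) → ℂ) (τ : ι → ℤ) (z : ι → ℂ) : ℂ :=
  (∏ ω ∈ D.Φ.filter (fun ω => 0 < pairZ ω τ), ffall (evalC ω z - k ω) (pairZ ω τ)) /
  (∏ α ∈ D.Δ.filter (fun α => 0 < pairZ α τ), ffall (evalC α z) (pairZ α τ))

/-- The virtual dimension `d_λ = (-1)^{ℓ(λ)} f_λ(-ρ) / f_λ(ρ+λ)`. -/
def vdim (k : (ι → ℤ) → ℂ) (ρ : ι → ℂ) (lam : ι → ℤ) : ℂ :=
  (-1 : ℂ) ^ (pairZ D.ell lam) * D.fgen k lam (-ρ) / D.fgen k lam (ρ + toV lam)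

/-- The rational function `b_τ^h` (formula (Def-b-t)); here the sum runs over
all paths from `0` to `τ` of length `d = ℓ(τ)`. -/
def bfun (k : (ι → ℤ) → ℂ) (h : MvPolynomial ι ℂ) (τ : ι → ℤ) (z : ι → ℂ) : ℂ :=
  ∑ s ∈ paths D 0 τ (pairZ D.ell τ).toNat,
    (∑ i ∈ Finset.range ((pairZ D.ell τ).toNat + 1),
      ((-1 : ℂ) ^ ((pairZ D.ell τ).toNat - i) /
        ((Nat.factorial i : ℂ) * (Nat.factorial ((pairZ D.ell τ).toNat - i) : ℂ))) *
        eval (z - toV (pathPt 0 s i)) h) *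
    ∏ i : Fin (pairZ D.ell τ).toNat, D.fgen k (s i) (z - toV (pathPt 0 s (i : ℕ)))

/-- The difference operator `D_h = Σ_{τ ∈ Λ} b_τ^h T_τ`, acting on functions on `V`. -/
def Dop (k : (ι → ℤ) → ℂ) (h : MvPolynomial ι ℂ) (F : (ι → ℂ) → ℂ) (z : ι → ℂ) : ℂ :=
  ∑ᶠ τ ∈ (D.Lam : Set (ι → ℤ)), D.bfun k h τ z * F (z - toV τ)

/-- The order relation on `Λ`: `τ₁ ≤ τ₂` iff `ℓ(τ₁) < ℓ(τ₂)`, or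
`ℓ(τ₁) = ℓ(τ₂)` and `τ₂ - τ₁` is a sum of positive coroots. -/
def ordLe (τ₁ τ₂ : ι → ℤ) : Prop :=
  pairZ D.ell τ₁ < pairZ D.ell τ₂ ∨
    (pairZ D.ell τ₁ = pairZ D.ell τ₂ ∧
      τ₂ - τ₁ ∈ AddSubmonoid.closure (D.coroot '' (D.Δpos : Set (ι → ℤ))))

end Data


set_option linter.unusedSectionVars false
set_option linter.unusedDecidableInType false
set_option linter.unusedFintypeInType false

abbrev LatAut (ι : Type*) := (ι → ℤ) ≃ₗ[ℤ] (ι → ℤ)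

lemma pairZ_add_left (a b η : ι → ℤ) : pairZ (a + b) η = pairZ a η + pairZ b η := by
  simp [pairZ, add_mul, Finset.sum_add_distrib]

lemma pairZ_add_right (a η θ : ι → ℤ) : pairZ a (η + θ) = pairZ a η + pairZ a θ := by
  simp [pairZ, mul_add, Finset.sum_add_distrib]

lemma pairZ_neg_left (a η : ι → ℤ) : pairZ (-a) η = -pairZ a η := by
  simp [pairZ]

lemma pairZ_sub_left (a b η : ι → ℤ) : pairZ (a - b) η = pairZ a η - pairZ b η := by
  simp [pairZ, sub_mul, Finset.sum_sub_distrib]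

lemma pairZ_sub_right (a η θ : ι → ℤ) : pairZ a (η - θ) = pairZ a η - pairZ a θ := by
  simp [pairZ, mul_sub, Finset.sum_sub_distrib]

lemma pairZ_smul_left (n : ℤ) (a η : ι → ℤ) : pairZ (n • a) η = n * pairZ a η := by
  simp [pairZ, Finset.mul_sum, mul_assoc]

lemma pairZ_smul_right (n : ℤ) (a η : ι → ℤ) : pairZ a (n • η) = n * pairZ a η := by
  simp [pairZ, Finset.mul_sum, mul_left_comm]

lemma pairZ_zero_left (η : ι → ℤ) : pairZ 0 η = 0 := by simp [pairZ]

lemma pairZ_zero_right (a : ι → ℤ) : pairZ a 0 = 0 := by simp [pairZ]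

lemma pairZ_sum_left {κ : Type*} (s : Finset κ) (g : κ → ι → ℤ) (η : ι → ℤ) :
    pairZ (∑ j ∈ s, g j) η = ∑ j ∈ s, pairZ (g j) η := by
  simp only [pairZ, Finset.sum_apply, Finset.sum_mul]
  exact Finset.sum_comm

lemma pairZ_e_left (i : ι) (η : ι → ℤ) : pairZ (e i) η = η i := by
  simp [pairZ, e, Pi.single_apply]

lemma pairZ_e_right (i : ι) (a : ι → ℤ) : pairZ a (e i) = a i := by
  simp [pairZ, e, Pi.single_apply]

lemma e_apply (i j : ι) : (e i : ι → ℤ) j = if j = i then 1 else 0 := by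
  simp [e, Pi.single_apply]

lemma sum_smul_e (η : ι → ℤ) : ∑ i, η i • e i = η := by
  funext j
  simp [Finset.sum_apply, e_apply]

lemma map_eq_sum (w : LatAut ι) (x : ι → ℤ) : w x = ∑ i, x i • w (e i) := by
  conv_lhs => rw [← sum_smul_e x]
  rw [map_sum]
  exact Finset.sum_congr rfl fun i _ => map_smul _ _ _

lemma evalC_neg (a : ι → ℤ) (z : ι → ℂ) : evalC (-a) z = -evalC a z := by
  simp [evalC]

lemma evalC_sub (a b : ι → ℤ) (z : ι → ℂ) : evalC (a - b) z = evalC a z - evalC b z := by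
  simp [evalC, sub_mul, Finset.sum_sub_distrib]

lemma evalC_smul (n : ℤ) (a : ι → ℤ) (z : ι → ℂ) : evalC (n • a) z = n * evalC a z := by
  simp [evalC, Finset.mul_sum, mul_assoc]

lemma evalC_sum {κ : Type*} (s : Finset κ) (g : κ → ι → ℤ) (z : ι → ℂ) :
    evalC (∑ j ∈ s, g j) z = ∑ j ∈ s, evalC (g j) z := by
  simp only [evalC, Finset.sum_apply, Int.cast_sum, Finset.sum_mul]
  exact Finset.sum_comm

lemma evalC_e (i : ι) (z : ι → ℂ) : evalC (e i) z = z i := by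
  simp [evalC, e_apply]

lemma evalC_vadd (a : ι → ℤ) (y z : ι → ℂ) : evalC a (y + z) = evalC a y + evalC a z := by
  simp [evalC, mul_add, Finset.sum_add_distrib]

lemma evalC_vsub (a : ι → ℤ) (y z : ι → ℂ) : evalC a (y - z) = evalC a y - evalC a z := by
  simp [evalC, mul_sub, Finset.sum_sub_distrib]

lemma evalC_vsmul (a : ι → ℤ) (c : ℂ) (z : ι → ℂ) : evalC a (c • z) = c * evalC a z := by
  simp [evalC, Finset.mul_sum, mul_left_comm]

lemma evalC_toV (a η : ι → ℤ) : evalC a (toV η) = (pairZ a η : ℂ) := by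
  simp [evalC, toV, pairZ]

lemma toV_add (η θ : ι → ℤ) : toV (η + θ) = toV η + toV θ := by
  funext i; simp [toV]

lemma toV_sub (η θ : ι → ℤ) : toV (η - θ) = toV η - toV θ := by
  funext i; simp [toV]

lemma toV_smul (n : ℤ) (θ : ι → ℤ) : toV (n • θ) = (n : ℂ) • toV θ := by
  funext i; simp [toV]

lemma toV_zero : toV (0 : ι → ℤ) = 0 := by
  funext i; simp [toV]

lemma pairZ_actDual (w : LatAut ι) (a η : ι → ℤ) :
    pairZ a (actDual w η) = pairZ (w.symm a) η := by
  rw [map_eq_sum w.symm a, pairZ_sum_left]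
  simp only [pairZ_smul_left]
  rfl

lemma evalC_actV (w : LatAut ι) (a : ι → ℤ) (z : ι → ℂ) :
    evalC a (actV w z) = evalC (w.symm a) z := by
  rw [map_eq_sum w.symm a, evalC_sum]
  simp only [evalC_smul]
  rfl

lemma pairZ_left_ext {η θ : ι → ℤ} (h : ∀ i, pairZ (e i) η = pairZ (e i) θ) : η = θ := by
  funext i; simpa [pairZ_e_left] using h i

lemma evalC_ext {y z : ι → ℂ} (h : ∀ i, evalC (e i) y = evalC (e i) z) : y = z := by
  funext i; simpa [evalC_e] using h i

lemma LatAut.mul_symm_apply (w v : LatAut ι) (x : ι → ℤ) :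
    (w * v).symm x = v.symm (w.symm x) := by
  apply (w * v).injective
  simp [LinearEquiv.mul_apply]

lemma LatAut.inv_apply_eq_symm (w : LatAut ι) (x : ι → ℤ) : w⁻¹ x = w.symm x := rfl

lemma actV_mul (w v : LatAut ι) (z : ι → ℂ) : actV (w * v) z = actV w (actV v z) := by
  refine evalC_ext fun i => ?_
  rw [evalC_actV, evalC_actV, evalC_actV, LatAut.mul_symm_apply]

lemma actDual_mul (w v : LatAut ι) (η : ι → ℤ) :
    actDual (w * v) η = actDual w (actDual v η) := by
  refine pairZ_left_ext fun i => ?_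
  rw [pairZ_actDual, pairZ_actDual, pairZ_actDual, LatAut.mul_symm_apply]

lemma actV_one (z : ι → ℂ) : actV 1 z = z := by
  refine evalC_ext fun i => ?_
  rw [evalC_actV]; rfl

lemma actDual_one (η : ι → ℤ) : actDual 1 η = η := by
  refine pairZ_left_ext fun i => ?_
  rw [pairZ_actDual]; rfl

lemma actDual_inv_actDual (w : LatAut ι) (η : ι → ℤ) : actDual w⁻¹ (actDual w η) = η := by
  rw [← actDual_mul, inv_mul_cancel, actDual_one]

lemma actDual_actDual_inv (w : LatAut ι) (η : ι → ℤ) : actDual w (actDual w⁻¹ η) = η := by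
  rw [← actDual_mul, mul_inv_cancel, actDual_one]

lemma actV_add (w : LatAut ι) (y z : ι → ℂ) : actV w (y + z) = actV w y + actV w z := by
  refine evalC_ext fun i => ?_
  simp only [evalC_actV, evalC_vadd]

lemma actV_sub (w : LatAut ι) (y z : ι → ℂ) : actV w (y - z) = actV w y - actV w z := by
  refine evalC_ext fun i => ?_
  simp only [evalC_actV, evalC_vsub]

lemma actV_toV (w : LatAut ι) (η : ι → ℤ) : actV w (toV η) = toV (actDual w η) := by
  refine evalC_ext fun i => ?_
  rw [evalC_actV, evalC_toV, evalC_toV, pairZ_actDual]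

section Reflections

variable {a c : ι → ℤ} {w : LatAut ι}

lemma reflMap_reflMap (hc : pairZ a c = 2) (x : ι → ℤ) :
    reflMap a c (reflMap a c x) = x := by
  simp only [reflMap, pairZ_sub_left, pairZ_smul_left, hc]
  module

lemma refl_symm (hc : pairZ a c = 2) (hw : ∀ x, w x = reflMap a c x) (x : ι → ℤ) :
    w.symm x = reflMap a c x := by
  apply w.injective
  rw [hw (reflMap a c x), reflMap_reflMap hc, LinearEquiv.apply_symm_apply]

lemma actV_refl (hc : pairZ a c = 2) (hw : ∀ x, w x = reflMap a c x) (z : ι → ℂ) :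
    actV w z = z - evalC a z • toV c := by
  refine evalC_ext fun i => ?_
  rw [evalC_actV, refl_symm hc hw, reflMap]
  simp only [evalC_sub, evalC_smul, evalC_vsub, evalC_vsmul, evalC_toV]
  ring

end Reflections

namespace Data

variable (D : Data ι)

lemma Φ_stable {w : LatAut ι} (hw : w ∈ D.W) {ω : ι → ℤ} (hω : ω ∈ D.Φ) : w ω ∈ D.Φ := by
  obtain ⟨v, hv, i, rfl⟩ := (D.Φ_spec _).1 hω
  exact (D.Φ_spec _).2 ⟨w * v, D.W.mul_mem hw hv, i, rfl⟩

lemma Φ_stable_symm {w : LatAut ι} (hw : w ∈ D.W) {ω : ι → ℤ} (hω : ω ∈ D.Φ) :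
    w.symm ω ∈ D.Φ := D.Φ_stable (D.W.inv_mem hw) hω

lemma e_mem_Φ (i : ι) : e i ∈ D.Φ := (D.Φ_spec _).2 ⟨1, D.W.one_mem, i, rfl⟩

lemma Λ₁_stable {w : LatAut ι} (hw : w ∈ D.W) {η : ι → ℤ} (hη : η ∈ D.Λ₁) :
    actDual w η ∈ D.Λ₁ := by
  obtain ⟨v, hv, i, hi, rfl⟩ := (D.Λ₁_spec _).1 hη
  exact (D.Λ₁_spec _).2 ⟨w * v, D.W.mul_mem hw hv, i, hi, (actDual_mul _ _ _).symm⟩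

lemma ell_symm {w : LatAut ι} (hw : w ∈ D.W) : w.symm D.ell = D.ell :=
  D.C4 _ (D.W.inv_mem hw)

lemma ell_actDual {w : LatAut ι} (hw : w ∈ D.W) (η : ι → ℤ) :
    pairZ D.ell (actDual w η) = pairZ D.ell η := by
  rw [pairZ_actDual, D.ell_symm hw]

lemma ell_actV {w : LatAut ι} (hw : w ∈ D.W) (z : ι → ℂ) :
    evalC D.ell (actV w z) = evalC D.ell z := by
  rw [evalC_actV, D.ell_symm hw]

lemma ell_Λ₁ {η : ι → ℤ} (hη : η ∈ D.Λ₁) : pairZ D.ell η = 1 := by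
  obtain ⟨v, hv, i, hi, rfl⟩ := (D.Λ₁_spec _).1 hη
  rw [D.ell_actDual hv, pairZ_e_right, hi]

lemma ne_zero_of_mem_Δ {α : ι → ℤ} (hα : α ∈ D.Δ) : α ≠ 0 := by
  rintro rfl
  have := D.Δ_prim 0 hα 0 0 (by simp)
  simp at this

/-- The orbit `W·Δ`. -/
def roots : Finset (ι → ℤ) := (D.W_finite.toFinset ×ˢ D.Δ).image fun x => x.1 x.2

lemma mem_roots {γ : ι → ℤ} : γ ∈ D.roots ↔ ∃ w ∈ D.W, ∃ α ∈ D.Δ, γ = w α := by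
  simp only [roots, Finset.mem_image, Finset.mem_product, Set.Finite.mem_toFinset,
    SetLike.mem_coe, Prod.exists]
  constructor
  · rintro ⟨w, α, ⟨hw, hα⟩, rfl⟩
    exact ⟨w, hw, α, hα, rfl⟩
  · rintro ⟨w, hw, α, hα, rfl⟩
    exact ⟨w, α, ⟨hw, hα⟩, rfl⟩

lemma Δ_subset_roots : D.Δ ⊆ D.roots := fun α hα =>
  D.mem_roots.2 ⟨1, D.W.one_mem, α, hα, rfl⟩

lemma roots_stable {w : LatAut ι} (hw : w ∈ D.W) {γ : ι → ℤ} (hγ : γ ∈ D.roots) :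
    w γ ∈ D.roots := by
  obtain ⟨v, hv, α, hα, rfl⟩ := D.mem_roots.1 hγ
  exact D.mem_roots.2 ⟨w * v, D.W.mul_mem hw hv, α, hα, rfl⟩

lemma roots_neg {γ : ι → ℤ} (hγ : γ ∈ D.roots) : -γ ∈ D.roots := by
  obtain ⟨v, hv, α, hα, rfl⟩ := D.mem_roots.1 hγ
  exact D.mem_roots.2 ⟨v, hv, -α, D.Δ_neg α hα, by simp⟩

lemma roots_prim {γ : ι → ℤ} (hγ : γ ∈ D.roots) {n : ℤ} {β : ι → ℤ} (h : γ = n • β) :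
    IsUnit n := by
  obtain ⟨v, hv, α, hα, rfl⟩ := D.mem_roots.1 hγ
  refine D.Δ_prim α hα n (v.symm β) ?_
  rw [← map_smul, ← h, LinearEquiv.symm_apply_apply]

lemma ne_zero_of_mem_roots {γ : ι → ℤ} (hγ : γ ∈ D.roots) : γ ≠ 0 := by
  rintro rfl
  have := D.roots_prim hγ (n := 0) (β := 0) (by simp)
  simp at this

lemma exists_coroot {γ : ι → ℤ} (hγ : γ ∈ D.roots) :
    ∃ c : ι → ℤ, pairZ γ c = 2 ∧ ∃ w ∈ D.W, ∀ x, w x = reflMap γ c x := by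
  obtain ⟨v, hv, α, hα, rfl⟩ := D.mem_roots.1 hγ
  obtain ⟨s, hs, hsx⟩ := D.refl_mem α hα
  refine ⟨actDual v (D.coroot α), ?_, v * s * v⁻¹,
    D.W.mul_mem (D.W.mul_mem hv hs) (D.W.inv_mem hv), fun x => ?_⟩
  · rw [pairZ_actDual, LinearEquiv.symm_apply_apply, D.coroot_pair α hα]
  · rw [LinearEquiv.mul_apply, LinearEquiv.mul_apply, hsx, reflMap, reflMap, pairZ_actDual,
      map_sub, map_smul, LatAut.inv_apply_eq_symm, LinearEquiv.apply_symm_apply]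

lemma ell_coroot {γ c : ι → ℤ} (hγ : γ ∈ D.roots)
    {w : LatAut ι} (hw : w ∈ D.W) (hwx : ∀ x, w x = reflMap γ c x) : pairZ D.ell c = 0 := by
  have h := D.C4 w hw
  rw [hwx, reflMap, sub_eq_self] at h
  exact (smul_eq_zero.1 h).resolve_right (D.ne_zero_of_mem_roots hγ)

lemma k_apply {ρ : ι → ℂ} {k : (ι → ℤ) → ℂ} (hk : D.IsK ρ k) {w : LatAut ι} (hw : w ∈ D.W)
    (i : ι) : k (w (e i)) = ρ i :=
  hk _ i ⟨w⁻¹, D.W.inv_mem hw, Or.inl (by simp [LatAut.inv_apply_eq_symm])⟩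

lemma k_stable {ρ : ι → ℂ} {k : (ι → ℤ) → ℂ} (hk : D.IsK ρ k) {w : LatAut ι} (hw : w ∈ D.W)
    {ω : ι → ℤ} (hω : ω ∈ D.Φ) : k (w ω) = k ω := by
  obtain ⟨v, hv, i, rfl⟩ := (D.Φ_spec _).1 hω
  rw [D.k_apply hk hv, ← LinearEquiv.mul_apply, D.k_apply hk (D.W.mul_mem hw hv)]

lemma exists_isK {ρ : ι → ℂ} (hρ : D.InV0 ρ) : ∃ k, D.IsK ρ k := by
  refine ⟨fun ω => if h : ∃ i, ∃ w ∈ D.W, e i = w ω ∨ e i = -(w ω) then ρ h.choose else 0,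
    fun ω i hi => ?_⟩
  have h : ∃ i, ∃ w ∈ D.W, e i = w ω ∨ e i = -(w ω) := ⟨i, hi⟩
  simp only [dif_pos h]
  obtain ⟨w, hw, h1⟩ := h.choose_spec
  obtain ⟨v, hv, h2⟩ := hi
  refine hρ _ _ ⟨w * v⁻¹, D.W.mul_mem hw (D.W.inv_mem hv), ?_⟩
  have key : w ω = (w * v⁻¹) (v ω) := by
    rw [LinearEquiv.mul_apply, LatAut.inv_apply_eq_symm, LinearEquiv.symm_apply_apply]
  rw [key] at h1
  rcases h1 with h1 | h1 <;> rcases h2 with h2 | h2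
  · left; rw [h1, h2]
  · right; rw [h1, h2, map_neg, neg_neg]
  · right; rw [h1, h2]
  · left; rw [h1, h2, map_neg]

end Data

section Polynomials

/-- The linear form `γ` as a polynomial. -/
def lin (γ : ι → ℤ) : MvPolynomial ι ℂ := ∑ i, C (γ i : ℂ) * X i

lemma eval_lin (γ : ι → ℤ) (z : ι → ℂ) : eval z (lin γ) = evalC γ z := by
  simp [lin, evalC]

lemma totalDegree_C_mul_le (c : ℂ) (p : MvPolynomial ι ℂ) :
    (C c * p).totalDegree ≤ p.totalDegree :=
  (totalDegree_mul _ _).trans (by simp)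

lemma totalDegree_lin_le (γ : ι → ℤ) : (lin γ).totalDegree ≤ 1 :=
  totalDegree_finsetSum_le fun i _ => (totalDegree_C_mul_le _ _).trans (by simp)

lemma totalDegree_lin_sub_C_le (γ : ι → ℤ) (c : ℂ) : (lin γ - C c).totalDegree ≤ 1 :=
  (totalDegree_sub _ _).trans (max_le (totalDegree_lin_le γ) (by simp))

lemma evalC_single (γ : ι → ℤ) (i : ι) (c : ℂ) : evalC γ (Pi.single i c) = γ i * c := by
  simp [evalC, Pi.single_apply]

lemma one_le_totalDegree_lin_sub_C {γ : ι → ℤ} (hγ : γ ≠ 0) (c : ℂ) :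
    1 ≤ (lin γ - C c).totalDegree := by
  by_contra! hlt
  obtain ⟨i, hi⟩ := Function.ne_iff.1 hγ
  have h0 := totalDegree_eq_zero_iff_eq_C.1 (Nat.lt_one_iff.1 hlt)
  have h1 := congrArg (eval (Pi.single i (1 : ℂ))) h0
  have h2 := congrArg (eval (0 : ι → ℂ)) h0
  simp only [map_sub, eval_lin, eval_C, evalC_single] at h1 h2
  have : evalC γ (0 : ι → ℂ) = 0 := by simp [evalC]
  rw [this] at h2
  have h3 : (γ i : ℂ) = 0 := by linear_combination h1 - h2
  exact hi (by exact_mod_cast h3)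

lemma lin_ne_zero {γ : ι → ℤ} (hγ : γ ≠ 0) : lin γ ≠ 0 := by
  intro h
  have := one_le_totalDegree_lin_sub_C hγ 0
  simp [h] at this

lemma eval_bind₁' (g : ι → MvPolynomial ι ℂ) (p : MvPolynomial ι ℂ) (z : ι → ℂ) :
    eval z (bind₁ g p) = eval (fun i => eval z (g i)) p := by
  simpa using eval₂Hom_bind₁ (RingHom.id ℂ) z g p

lemma totalDegree_bind₁_le (g : ι → MvPolynomial ι ℂ) (hg : ∀ i, (g i).totalDegree ≤ 1)
    (p : MvPolynomial ι ℂ) : (bind₁ g p).totalDegree ≤ p.totalDegree := by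
  conv_lhs => rw [p.as_sum, map_sum]
  refine totalDegree_finsetSum_le fun m hm => ?_
  rw [bind₁_monomial]
  refine (totalDegree_C_mul_le _ _).trans ((totalDegree_finsetProd _ _).trans ?_)
  refine (Finset.sum_le_sum fun i _ => (totalDegree_pow (g i) (m i)).trans
    (Nat.mul_le_mul_left _ (hg i))).trans ?_
  simpa [Finsupp.sum] using le_totalDegree hm

lemma dvd_sub_bind₁ (a : MvPolynomial ι ℂ) (g : ι → MvPolynomial ι ℂ)
    (h : ∀ i, a ∣ X i - g i) (p : MvPolynomial ι ℂ) : a ∣ p - bind₁ g p := by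
  induction p using MvPolynomial.induction_on with
  | C c => simp
  | add p q hp hq =>
    rw [map_add, add_sub_add_comm]
    exact dvd_add hp hq
  | mul_X p i hp =>
    have : p * X i - bind₁ g (p * X i) = (p - bind₁ g p) * X i + bind₁ g p * (X i - g i) := by
      rw [map_mul, bind₁_X_right]; ring
    rw [this]
    exact dvd_add (Dvd.dvd.mul_right hp _) (Dvd.dvd.mul_left (h i) _)

/-- The divided difference of `p` along the affine reflection in `γ = n`. -/
lemma exists_divided_difference {γ : ι → ℤ} (hγ : γ ≠ 0) (c : ι → ℤ) (n : ℂ)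
    (p : MvPolynomial ι ℂ) :
    ∃ q : MvPolynomial ι ℂ, (q ≠ 0 → q.totalDegree + 1 ≤ p.totalDegree) ∧
      ∀ z, (evalC γ z - n) * eval z q = eval z p - eval (z - (evalC γ z - n) • toV c) p := by
  set g : ι → MvPolynomial ι ℂ := fun i => X i - C (c i : ℂ) * (lin γ - C n) with hg
  obtain ⟨q, hq⟩ := dvd_sub_bind₁ (lin γ - C n) g
    (fun i => ⟨C (c i : ℂ), by simp only [hg]; ring⟩) p
  refine ⟨q, fun hq0 => ?_, fun z => ?_⟩
  · have h1 := one_le_totalDegree_lin_sub_C hγ n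
    have ha : lin γ - C n ≠ 0 := by
      intro h; rw [h] at h1; simp at h1
    have h2 := totalDegree_mul_of_isDomain ha hq0
    rw [← hq] at h2
    have h3 : (p - bind₁ g p).totalDegree ≤ p.totalDegree := by
      refine (totalDegree_sub _ _).trans (max_le le_rfl (totalDegree_bind₁_le g (fun i => ?_) p))
      exact (totalDegree_sub _ _).trans (max_le (by simp)
        ((totalDegree_C_mul_le _ _).trans (totalDegree_lin_sub_C_le _ _)))
    omega
  · have := congrArg (eval z) hq
    rw [map_mul, map_sub, map_sub, eval_bind₁', eval_lin, eval_C] at this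
    rw [← this]
    congr 2
    congr 1
    funext i
    simp [hg, eval_lin, toV, mul_comm]

/-- The polynomial `z ↦ p(w z)`. -/
def actP (w : LatAut ι) (p : MvPolynomial ι ℂ) : MvPolynomial ι ℂ :=
  bind₁ (fun i => lin (w.symm (e i))) p

lemma eval_actP (w : LatAut ι) (p : MvPolynomial ι ℂ) (z : ι → ℂ) :
    eval z (actP w p) = eval (actV w z) p := by
  rw [actP, eval_bind₁']
  simp only [eval_lin]
  rfl

lemma totalDegree_actP_le (w : LatAut ι) (p : MvPolynomial ι ℂ) :
    (actP w p).totalDegree ≤ p.totalDegree :=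
  totalDegree_bind₁_le _ (fun _ => totalDegree_lin_le _) p

/-- A projection onto the hyperplane `γ = 0`. -/
lemma exists_hyperplane_projection {γ : ι → ℤ} (hγ : γ ≠ 0) :
    ∃ g : ι → MvPolynomial ι ℂ, (∀ p, lin γ ∣ p - bind₁ g p) ∧
      (∀ z, evalC γ (fun i => eval z (g i)) = 0) ∧
      (∀ z, evalC γ z = 0 → (fun i => eval z (g i)) = z) := by
  obtain ⟨j, hj⟩ := Function.ne_iff.1 hγ
  have hj' : (γ j : ℂ) ≠ 0 := by exact_mod_cast hj
  set u : ι → ℂ := Pi.single j (γ j : ℂ)⁻¹ with hu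
  have hγu : evalC γ u = 1 := by rw [hu, evalC_single]; field_simp
  have key : ∀ z, (fun i => eval z (X i - C (u i) * lin γ)) = z - evalC γ z • u := by
    intro z; funext i; simp [eval_lin, mul_comm]
  refine ⟨fun i => X i - C (u i) * lin γ, fun p => dvd_sub_bind₁ _ _ (fun i => ⟨C (u i), by ring⟩) p,
    fun z => ?_, fun z hz => ?_⟩
  · rw [key, evalC_vsub, evalC_vsmul, hγu]; ring
  · rw [key, hz]; simp

/-- A polynomial vanishing on pairwise distinct hyperplanes is divisible by the product of
the corresponding linear forms. -/
lemma prod_lin_dvd (S : Finset (ι → ℤ)) (h0 : ∀ α ∈ S, α ≠ 0)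
    (hind : ∀ α ∈ S, ∀ β ∈ S, α ≠ β → ∃ z, evalC α z = 0 ∧ evalC β z ≠ 0)
    (G : MvPolynomial ι ℂ) (hG : ∀ α ∈ S, ∀ z, evalC α z = 0 → eval z G = 0) :
    (∏ α ∈ S, lin α) ∣ G := by
  induction S using Finset.induction_on generalizing G with
  | empty => simp
  | insert β S hβ ih =>
    obtain ⟨g, hg1, hg2, hg3⟩ := exists_hyperplane_projection (h0 β (by simp))
    obtain ⟨G', rfl⟩ := ih (fun α hα => h0 α (by simp [hα]))
      (fun α hα γ hγ => hind α (by simp [hα]) γ (by simp [hγ])) G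
      (fun α hα => hG α (by simp [hα]))
    have hz : bind₁ g G' = 0 := by
      have h1 : bind₁ g ((∏ α ∈ S, lin α) * G') = 0 := by
        refine MvPolynomial.funext fun z => ?_
        rw [eval_bind₁', hG β (by simp) _ (hg2 z), map_zero]
      rw [map_mul, mul_eq_zero] at h1
      refine h1.resolve_left ?_
      rw [map_prod, Finset.prod_eq_zero_iff]
      rintro ⟨α, hα, h2⟩
      have hne : β ≠ α := fun h => hβ (h ▸ hα)
      obtain ⟨z, hz1, hz2⟩ := hind β (by simp) α (by simp [hα]) hne
      have h3 := congrArg (eval z) h2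
      rw [eval_bind₁', hg3 z hz1, eval_lin, map_zero] at h3
      exact hz2 h3
    have h4 := hg1 G'
    rw [hz, sub_zero] at h4
    rw [Finset.prod_insert hβ, mul_comm (lin β)]
    exact mul_dvd_mul_left _ h4

end Polynomials

namespace Data

variable (D : Data ι)

section Interpolation

/-- The elements of `Λ₊` of level at most `N`. -/
def pts (N : ℕ) : Finset (ι → ℤ) :=
  (Fintype.piFinset fun _ => Finset.Icc (0 : ℤ) N).filter fun μ => pairZ D.ell μ ≤ N

lemma apply_le_pairZ_ell {μ : ι → ℤ} (hμ : μ ∈ LamPlus) (i : ι) : μ i ≤ pairZ D.ell μ := by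
  have h1 : ∀ j ∈ Finset.univ, 0 ≤ D.ell j * μ j := fun j _ => mul_nonneg (D.C6 j).le (hμ j)
  have h2 : D.ell i * μ i ≤ pairZ D.ell μ := Finset.single_le_sum h1 (Finset.mem_univ i)
  nlinarith [D.C6 i, hμ i]

lemma pairZ_ell_nonneg {μ : ι → ℤ} (hμ : μ ∈ LamPlus) : 0 ≤ pairZ D.ell μ :=
  Finset.sum_nonneg fun j _ => mul_nonneg (D.C6 j).le (hμ j)

lemma mem_pts {N : ℕ} {μ : ι → ℤ} : μ ∈ D.pts N ↔ μ ∈ LamPlus ∧ pairZ D.ell μ ≤ N := by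
  simp only [pts, Finset.mem_filter, Fintype.mem_piFinset, Finset.mem_Icc]
  exact ⟨fun h => ⟨fun i => (h.1 i).1, h.2⟩,
    fun h => ⟨fun i => ⟨h.1 i, (D.apply_le_pairZ_ell h.1 i).trans h.2⟩, h.2⟩⟩

lemma WInv.add {p q : MvPolynomial ι ℂ} (hp : D.WInv p) (hq : D.WInv q) : D.WInv (p + q) :=
  fun w hw z => by rw [map_add, map_add, hp w hw, hq w hw]

lemma WInv.C_mul (c : ℂ) {p : MvPolynomial ι ℂ} (hp : D.WInv p) : D.WInv (C c * p) :=
  fun w hw z => by rw [map_mul, map_mul, hp w hw, eval_C, eval_C]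

/-- The invariant polynomials of degree at most `N`. -/
def invPoly (N : ℕ) : Submodule ℂ (MvPolynomial ι ℂ) where
  carrier := {p | D.WInv p ∧ p.totalDegree ≤ N}
  add_mem' := fun {p q} hp hq =>
    ⟨WInv.add D hp.1 hq.1, (totalDegree_add p q).trans (max_le hp.2 hq.2)⟩
  zero_mem' := ⟨fun w _ z => by simp, by simp⟩
  smul_mem' := fun c p hp => by
    rw [MvPolynomial.smul_eq_C_mul]
    exact ⟨WInv.C_mul D c hp.1, (totalDegree_C_mul_le c p).trans hp.2⟩

/-- Evaluation of invariant polynomials at the points `ρ + μ`, `μ ∈ Λ₊`, `ℓ(μ) ≤ N`. -/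
def evalMap (ρ : ι → ℂ) (N : ℕ) : D.invPoly N →ₗ[ℂ] (D.pts N → ℂ) where
  toFun p := fun μ => eval (ρ + toV μ.1) p.1
  map_add' p q := by funext μ; simp
  map_smul' c p := by funext μ; simp [MvPolynomial.smul_eq_C_mul]

lemma evalMap_apply (ρ : ι → ℂ) (N : ℕ) (p : D.invPoly N) (μ : D.pts N) :
    D.evalMap ρ N p μ = eval (ρ + toV μ.1) p.1 := rfl

lemma eq_zero_of_injective {ρ : ι → ℂ} {N : ℕ} (hinj : Function.Injective (D.evalMap ρ N))
    {q : MvPolynomial ι ℂ} (hq : D.WInv q) (hdeg : q.totalDegree ≤ N)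
    (hv : ∀ μ ∈ LamPlus, pairZ D.ell μ ≤ N → eval (ρ + toV μ) q = 0) : q = 0 := by
  have h : (⟨q, hq, hdeg⟩ : D.invPoly N) = 0 := by
    apply hinj
    rw [map_zero]
    funext μ
    obtain ⟨h1, h2⟩ := D.mem_pts.1 μ.2
    exact hv μ.1 h1 h2
  exact congrArg Subtype.val h

lemma evalMap_surjective_of_capelli {ρ : ι → ℂ} {N : ℕ}
    (h : ∀ lam ∈ LamPlus, ∃ p, D.CapelliAt ρ lam p) :
    Function.Surjective (D.evalMap ρ N) := by
  suffices hs : ∀ n : ℕ, ∀ lam : D.pts N, (N : ℤ) - pairZ D.ell lam.1 < n →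
      (Pi.single lam 1 : D.pts N → ℂ) ∈ LinearMap.range (D.evalMap ρ N) by
    rw [← LinearMap.range_eq_top, eq_top_iff]
    intro v _
    rw [pi_eq_sum_univ' v]
    refine Submodule.sum_mem _ fun lam _ => Submodule.smul_mem _ _ ?_
    have := hs (N + 1) lam (by
      have := D.pairZ_ell_nonneg (D.mem_pts.1 lam.2).1
      push_cast; omega)
    convert this using 1
  intro n
  induction n with
  | zero =>
    intro lam hlam
    have := (D.mem_pts.1 lam.2).2
    push_cast at hlam
    omega
  | succ n ih =>
    intro lam hlam
    obtain ⟨hlam1, hlam2⟩ := D.mem_pts.1 lam.2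
    obtain ⟨p, hp1, hp2, hp3⟩ := h lam.1 hlam1
    set P : D.invPoly N := ⟨p, hp1, by exact_mod_cast hp2.trans hlam2⟩ with hP
    have h1 : D.evalMap ρ N P - ∑ ν ∈ Finset.univ.erase lam,
        D.evalMap ρ N P ν • (Pi.single ν 1 : D.pts N → ℂ) = Pi.single lam 1 := by
      funext κ
      simp only [Pi.sub_apply, Finset.sum_apply, Pi.smul_apply, Pi.single_apply, smul_eq_mul,
        mul_ite, mul_one, mul_zero, Finset.sum_ite_eq, Finset.mem_erase, Finset.mem_univ, and_true]
      by_cases hκ : κ = lam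
      · subst hκ
        simp [evalMap_apply, hP, hp3 κ.1 hlam1 le_rfl]
      · simp [hκ]
    rw [← h1]
    refine Submodule.sub_mem _ ⟨P, rfl⟩ (Submodule.sum_mem _ fun ν hν => ?_)
    by_cases hlt : pairZ D.ell lam.1 < pairZ D.ell ν.1
    · exact Submodule.smul_mem _ _ (ih ν (by push_cast at hlam; omega))
    · have h2 : D.evalMap ρ N P ν = 0 := by
        rw [evalMap_apply, hP, hp3 ν.1 (D.mem_pts.1 ν.2).1 (not_lt.1 hlt), if_neg]
        exact fun h => (Finset.mem_erase.1 hν).1 (Subtype.ext h)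
      rw [h2, zero_smul]
      exact Submodule.zero_mem _

lemma evalMap_injective_of_surjective {ρ ρ' : ι → ℂ} {N : ℕ}
    (hinj : Function.Injective (D.evalMap ρ' N)) (hsurj : Function.Surjective (D.evalMap ρ N)) :
    Function.Injective (D.evalMap ρ N) := by
  have : Module.Finite ℂ (D.invPoly N) := Module.Finite.of_injective (D.evalMap ρ' N) hinj
  refine (LinearMap.injective_iff_surjective_of_finrank_eq_finrank (le_antisymm
    (LinearMap.finrank_le_finrank_of_injective hinj)
    (LinearMap.finrank_le_finrank_of_surjective hsurj))).2 hsurj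

lemma exists_ell_eq_one [Nonempty ι] : ∃ i, D.ell i = 1 := by
  by_contra! hne
  have h := D.C8 (fun i => (D.ell i : ℂ)) 0 (fun w hw z => D.ell_actV hw z) (by simp)
    (fun i hi => absurd hi (hne i))
  obtain ⟨i⟩ := ‹Nonempty ι›
  have h1 := congrFun h i
  have h2 := D.C6 i
  simp at h1
  omega

lemma evalMap_injective_of_unique {ρ : ι → ℂ} (N : ℕ)
    (h : ∀ lam : ι → ℤ, lam ∈ LamPlus →
      ∃! p : MvPolynomial ι ℂ, D.WInv p ∧ p.totalDegree = (pairZ D.ell lam).toNat ∧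
        ∀ μ : ι → ℤ, μ ∈ LamPlus → pairZ D.ell μ ≤ pairZ D.ell lam →
          eval (ρ + toV μ) p = if μ = lam then 1 else 0) :
    Function.Injective (D.evalMap ρ N) := by
  rw [injective_iff_map_eq_zero]
  rintro ⟨q, hqW, hqd⟩ hq
  have hv : ∀ μ ∈ LamPlus, pairZ D.ell μ ≤ N → eval (ρ + toV μ) q = 0 := fun μ h1 h2 =>
    congrFun hq ⟨μ, D.mem_pts.2 ⟨h1, h2⟩⟩
  suffices q = 0 by subst this; rfl
  rcases isEmpty_or_nonempty ι with hι | hι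
  · refine MvPolynomial.funext fun z => ?_
    rw [Subsingleton.elim z (ρ + toV 0), map_zero]
    exact hv 0 (fun i => le_rfl) (by simp [pairZ])
  obtain ⟨j, hj⟩ := D.exists_ell_eq_one
  have hlam : ((N : ℤ) • e j : ι → ℤ) ∈ LamPlus := fun i => by
    simp only [Pi.smul_apply, e_apply, smul_eq_mul]; split_ifs <;> simp
  have hell : pairZ D.ell ((N : ℤ) • e j : ι → ℤ) = N := by
    rw [pairZ_smul_right, pairZ_e_right, hj, mul_one]
  obtain ⟨p, ⟨hp1, hp2, hp3⟩, huniq⟩ := h _ hlam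
  simp only [hell, Int.toNat_natCast] at hp2 hp3 huniq
  have hcomb : ∀ c : ℂ, (p + C c * q).totalDegree = N → C c * q = 0 := fun c hc => by
    have := huniq (p + C c * q) ⟨WInv.add D hp1 (WInv.C_mul D c hqW), hc, fun μ h1 h2 => by
      rw [map_add, map_mul, hv μ h1 h2, mul_zero, add_zero, hp3 μ h1 h2]⟩
    simpa using this
  have hle : ∀ c : ℂ, (p + C c * q).totalDegree ≤ N := fun c =>
    (totalDegree_add _ _).trans (max_le hp2.le ((totalDegree_C_mul_le c q).trans hqd))
  by_cases h1 : (p + C 1 * q).totalDegree = N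
  · simpa using hcomb 1 h1
  by_cases h2 : (p + C (-1) * q).totalDegree = N
  · simpa using hcomb (-1) h2
  exfalso
  have h3 : p = C (1 / 2) * ((p + C 1 * q) + (p + C (-1) * q)) := by
    have : C (-1 : ℂ) = (-1 : MvPolynomial ι ℂ) := by simp
    rw [this, C_1]
    have h4 : (C (1 / 2 : ℂ) : MvPolynomial ι ℂ) * 2 = 1 := by
      rw [show (2 : MvPolynomial ι ℂ) = C 2 from (map_ofNat C 2).symm, ← C_mul]; norm_num
    linear_combination (-p) * h4
  have h5 : p.totalDegree < N := by
    rw [h3]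
    refine (totalDegree_C_mul_le _ _).trans_lt ((totalDegree_add _ _).trans_lt (max_lt ?_ ?_))
    · exact lt_of_le_of_ne (hle 1) h1
    · exact lt_of_le_of_ne (hle (-1)) h2
  omega

lemma evalMap_injective_shift {ρ : ι → ℂ} (N : ℕ)
    (hinj : Function.Injective (D.evalMap ρ N)) (hsurj : Function.Surjective (D.evalMap ρ N)) :
    {t : ℂ | ¬ Function.Injective (D.evalMap (fun i => ρ i + t) N)}.Finite := by
  choose q hq using fun lam : D.pts N => hsurj (Pi.single lam 1)
  set M : Matrix (D.pts N) (D.pts N) (Polynomial ℂ) := fun lam μ =>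
    aeval (fun i => Polynomial.C (ρ i + toV μ.1 i) + Polynomial.X) (q lam).1 with hM
  have hMev : ∀ t lam μ, (M lam μ).eval t = eval ((fun i => ρ i + t) + toV μ.1) (q lam).1 := by
    intro t lam μ
    rw [hM]
    simp only
    rw [← Polynomial.coe_evalRingHom, aeval_def, MvPolynomial.hom_eval₂]
    have : (Polynomial.evalRingHom t).comp (algebraMap ℂ (Polynomial ℂ)) = RingHom.id ℂ := by
      ext x
      simp
    rw [this, eval, coe_eval₂Hom]
    congr 1
    funext i
    simp; ring
  have hdet : ∀ t, (M.det).eval t = (Matrix.of fun lam μ : D.pts N =>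
      eval ((fun i => ρ i + t) + toV μ.1) (q lam).1).det := by
    intro t
    rw [← Polynomial.coe_evalRingHom, RingHom.map_det]
    congr 1
    ext lam μ
    exact hMev t lam μ
  have hne : M.det ≠ 0 := by
    intro h0
    have h1 := hdet 0
    have h2 : (Matrix.of fun lam μ : D.pts N =>
      eval ((fun i => ρ i + (0 : ℂ)) + toV μ.1) (q lam).1) = 1 := by
      ext lam μ
      have := congrFun (hq lam) μ
      simp only [evalMap_apply] at this
      simp only [add_zero, Matrix.of_apply]
      rw [this, Pi.single_apply, Matrix.one_apply]
      simp [eq_comm]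
    rw [h0, h2] at h1
    simp at h1
  refine (M.det.roots.toFinset.finite_toSet).subset fun t ht => ?_
  rw [Finset.mem_coe, Multiset.mem_toFinset, Polynomial.mem_roots hne, Polynomial.IsRoot, hdet]
  by_contra hunit
  refine ht (D.evalMap_injective_of_surjective hinj fun v => ?_)
  set A := Matrix.of fun lam μ : D.pts N =>
      eval ((fun i => ρ i + t) + toV μ.1) (q lam).1 with hA
  refine ⟨∑ lam, (Matrix.vecMul v A⁻¹) lam • q lam, ?_⟩
  have h1 : Matrix.vecMul (Matrix.vecMul v A⁻¹) A = v := by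
    rw [Matrix.vecMul_vecMul, Matrix.nonsing_inv_mul _ (isUnit_iff_ne_zero.2 hunit),
      Matrix.vecMul_one]
  rw [map_sum]
  conv_rhs => rw [← h1]
  funext μ
  simp [Matrix.vecMul, dotProduct, evalMap_apply, hA]

end Interpolation

end Data

namespace Data

variable (D : Data ι)

lemma ell_eq_of_ne_coherent {γ c : ι → ℤ} (hc : pairZ γ c = 2) (hell : pairZ D.ell c = 0)
    {w : LatAut ι} (hw : w ∈ D.W) (hwx : ∀ x, w x = reflMap γ c x) {p n : ι}
    (hp : 0 < γ p) (hn : γ n < 0) :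
    w (e p) = e n ∧ γ = e p - e n ∧ c = e p - e n ∧ D.ell p = D.ell n := by
  have hpn : p ≠ n := by rintro rfl; omega
  have himg : ∀ i, (∀ m, 0 ≤ (if m = i then 1 else 0) - c i * γ m) ∨
      (∀ m, (if m = i then 1 else 0) - c i * γ m ≤ 0) := fun i => by
    have h := D.C3 _ (D.Φ_stable hw (D.e_mem_Φ i))
    simpa only [hwx, reflMap, pairZ_e_left, Pi.sub_apply, Pi.smul_apply, smul_eq_mul, e_apply]
      using h
  have hpos : ∀ i, 0 < c i → ∀ q, 0 < γ q → i = q ∧ c i = 1 ∧ γ q = 1 := by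
    intro i hi q hq
    rcases himg i with h | h
    · have h1 := h q
      split_ifs at h1 with hqi
      · refine ⟨hqi.symm, ?_, ?_⟩ <;> nlinarith
      · nlinarith
    · have h1 := h n
      split_ifs at h1 <;> nlinarith
  have hneg : ∀ i, c i < 0 → ∀ q, γ q < 0 → i = q ∧ c i = -1 ∧ γ q = -1 := by
    intro i hi q hq
    rcases himg i with h | h
    · have h1 := h q
      split_ifs at h1 with hqi
      · refine ⟨hqi.symm, ?_, ?_⟩ <;> nlinarith
      · nlinarith
    · have h1 := h p
      split_ifs at h1 <;> nlinarith
  have hex : (∃ i, 0 < c i) ∧ ∃ i, c i < 0 := by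
    have hne : c ≠ 0 := by
      rintro rfl
      rw [pairZ_zero_right] at hc
      omega
    constructor
    · by_contra! hall
      refine hne (funext fun i => ?_)
      have h1 := (Finset.sum_eq_zero_iff_of_nonpos fun j _ =>
        mul_nonpos_of_nonneg_of_nonpos (D.C6 j).le (hall j)).1 hell i (Finset.mem_univ i)
      exact (mul_eq_zero.1 h1).resolve_left (D.C6 i).ne'
    · by_contra! hall
      refine hne (funext fun i => ?_)
      have h1 := (Finset.sum_eq_zero_iff_of_nonneg fun j _ =>
        mul_nonneg (D.C6 j).le (hall j)).1 hell i (Finset.mem_univ i)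
      exact (mul_eq_zero.1 h1).resolve_left (D.C6 i).ne'
  obtain ⟨⟨i, hi⟩, j, hj⟩ := hex
  obtain ⟨rfl, hci, hγi⟩ := hpos i hi p hp
  obtain ⟨rfl, hcj, hγj⟩ := hneg j hj n hn
  have hγ : γ = e i - e j := by
    funext m
    rw [Pi.sub_apply, e_apply, e_apply]
    rcases lt_trichotomy (γ m) 0 with h | h | h
    · obtain ⟨rfl, -, h1⟩ := hneg j hj m h
      simp [h1, hpn.symm]
    · have h1 : m ≠ i := by rintro rfl; omega
      have h2 : m ≠ j := by rintro rfl; omega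
      simp [h, h1, h2]
    · obtain ⟨rfl, -, h1⟩ := hpos i hi m h
      simp [h1, hpn]
  have hceq : c = e i - e j := by
    funext m
    rw [Pi.sub_apply, e_apply, e_apply]
    rcases lt_trichotomy (c m) 0 with h | h | h
    · obtain ⟨rfl, h1, -⟩ := hneg m h j hn
      simp [h1, hpn.symm]
    · have h1 : m ≠ i := by rintro rfl; omega
      have h2 : m ≠ j := by rintro rfl; omega
      simp [h, h1, h2]
    · obtain ⟨rfl, h1, -⟩ := hpos m h i hp
      simp [h1, hpn]
  refine ⟨?_, hγ, hceq, ?_⟩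
  · rw [hwx, reflMap, pairZ_e_left, hci, one_smul, hγ]; abel
  · rw [hceq, pairZ_sub_right, pairZ_e_right, pairZ_e_right] at hell
    omega

/-- Every element of `W·Δ` is nonnegative or nonpositive. -/
lemma roots_coherent {ρ : ι → ℂ} (hρ : D.InV0 ρ)
    (hcap : ∀ lam ∈ LamPlus, ∃ p, D.CapelliAt ρ lam p) {γ : ι → ℤ} (hγ : γ ∈ D.roots) :
    (∀ i, 0 ≤ γ i) ∨ (∀ i, γ i ≤ 0) := by
  by_contra! hmix
  obtain ⟨⟨n, hn⟩, p, hp⟩ := hmix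
  obtain ⟨c, hc, w, hw, hwx⟩ := D.exists_coroot hγ
  obtain ⟨h1, h2, h3, h4⟩ := D.ell_eq_of_ne_coherent hc (D.ell_coroot hγ hw hwx) hw hwx hp hn
  have hpn : p ≠ n := by rintro rfl; omega
  have hρpn : ρ n = ρ p := hρ n p ⟨w, hw, Or.inl h1.symm⟩
  have hmem : ∀ i : ι, (e i : ι → ℤ) ∈ LamPlus := fun i j => by rw [e_apply]; split_ifs <;> simp
  obtain ⟨q, hq1, -, hq3⟩ := hcap (e p) (hmem p)
  have hv1 := hq3 (e p) (hmem p) le_rfl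
  have hv2 := hq3 (e n) (hmem n) (by rw [pairZ_e_right, pairZ_e_right, h4])
  have hne : (e n : ι → ℤ) ≠ e p := fun h => by
    have := congrFun h p
    simp [e_apply, hpn] at this
  rw [if_neg hne] at hv2
  rw [if_pos rfl, ← hq1 w hw] at hv1
  have hpt : actV w (ρ + toV (e p)) = ρ + toV (e n) := by
    have hval : evalC γ (ρ + toV (e p)) = 1 := by
      rw [evalC_vadd, evalC_toV, pairZ_e_right, h2, evalC_sub, evalC_e, evalC_e, hρpn]
      simp [e_apply, hpn]
    rw [actV_refl hc hwx, hval, one_smul, h3, toV_sub]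
    abel
  rw [hpt, hv2] at hv1
  exact zero_ne_one hv1

/-- The positive elements of `W·Δ`. -/
def posRoots : Finset (ι → ℤ) := D.roots.filter fun γ => ∀ i, 0 ≤ γ i

lemma mem_posRoots {γ : ι → ℤ} : γ ∈ D.posRoots ↔ γ ∈ D.roots ∧ ∀ i, 0 ≤ γ i := by
  simp [posRoots]

/-- All elements of `W·Δ` have coordinates of one sign. -/
def Coherent : Prop := ∀ γ ∈ D.roots, (∀ i, 0 ≤ γ i) ∨ (∀ i, γ i ≤ 0)

variable {D}

lemma sum_roots_abs (hD : D.Coherent) (x : (ι → ℤ) →+ ℝ) :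
    ∑ γ ∈ D.roots, |x γ| = 2 * ∑ γ ∈ D.posRoots, |x γ| := by
  have h1 : ∑ γ ∈ D.roots.filter (fun γ => ¬ ∀ i, 0 ≤ γ i), |x γ| = ∑ γ ∈ D.posRoots, |x γ| := by
    refine Finset.sum_bij' (fun γ _ => -γ) (fun γ _ => -γ) ?_ ?_ ?_ ?_ ?_
    · intro γ hγ
      obtain ⟨h1, h2⟩ := Finset.mem_filter.1 hγ
      exact D.mem_posRoots.2 ⟨D.roots_neg h1, fun i => by
        have := (hD γ h1).resolve_left h2 i
        simpa using this⟩
    · intro γ hγ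
      obtain ⟨h1, h2⟩ := D.mem_posRoots.1 hγ
      refine Finset.mem_filter.2 ⟨D.roots_neg h1, fun h3 => D.ne_zero_of_mem_roots h1 ?_⟩
      funext i
      have := h3 i
      have := h2 i
      simp at *
      omega
    · simp
    · simp
    · simp
  rw [← Finset.sum_filter_add_sum_filter_not D.roots (fun γ => ∀ i, 0 ≤ γ i), h1, posRoots]
  ring

lemma sum_roots_comp {w : LatAut ι} (hw : w ∈ D.W) (F : (ι → ℤ) → ℝ) :
    ∑ γ ∈ D.roots, F (w γ) = ∑ γ ∈ D.roots, F γ :=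
  Finset.sum_bij' (fun γ _ => w γ) (fun γ _ => w.symm γ)
    (fun _ h => D.roots_stable hw h) (fun _ h => D.roots_stable (D.W.inv_mem hw) h)
    (by simp) (by simp) (by simp)

lemma sum_posRoots_abs_comp (hD : D.Coherent) {w : LatAut ι} (hw : w ∈ D.W)
    (x : (ι → ℤ) →+ ℝ) : ∑ γ ∈ D.posRoots, |x (w γ)| = ∑ γ ∈ D.posRoots, |x γ| := by
  have h1 := sum_roots_abs hD x
  have h2 := sum_roots_abs hD (x.comp w.toLinearMap.toAddMonoidHom)
  have h3 := sum_roots_comp hw (fun γ => |x γ|)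
  have h4 : ∀ γ, (x.comp w.toLinearMap.toAddMonoidHom) γ = x (w γ) := fun _ => rfl
  simp only [h4] at h2
  linarith

lemma sum_posRoots_comp_le (hD : D.Coherent) {w : LatAut ι} (hw : w ∈ D.W)
    (x : (ι → ℤ) →+ ℝ) (hx : ∀ γ ∈ D.posRoots, 0 ≤ x γ) :
    ∑ γ ∈ D.posRoots, x (w γ) ≤ ∑ γ ∈ D.posRoots, x γ :=
  calc _ ≤ ∑ γ ∈ D.posRoots, |x (w γ)| := Finset.sum_le_sum fun _ _ => le_abs_self _
    _ = ∑ γ ∈ D.posRoots, |x γ| := sum_posRoots_abs_comp hD hw x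
    _ = _ := Finset.sum_congr rfl fun γ hγ => abs_of_nonneg (hx γ hγ)

lemma le_sum_posRoots_comp (hD : D.Coherent) {w : LatAut ι} (hw : w ∈ D.W)
    (x : (ι → ℤ) →+ ℝ) (hx : ∀ γ ∈ D.posRoots, x γ ≤ 0) :
    ∑ γ ∈ D.posRoots, x γ ≤ ∑ γ ∈ D.posRoots, x (w γ) := by
  have := sum_posRoots_comp_le hD hw (-x) (fun γ hγ => by simpa using hx γ hγ)
  simpa using this

lemma sum_posRoots_refl_lt (hD : D.Coherent) {w : LatAut ι} (hw : w ∈ D.W)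
    (x : (ι → ℤ) →+ ℝ) (hx : ∀ γ ∈ D.posRoots, 0 ≤ x γ) {α : ι → ℤ} (hα : α ∈ D.posRoots)
    (hxα : 0 < x α) (hwα : w α = -α) :
    ∑ γ ∈ D.posRoots, x (w γ) < ∑ γ ∈ D.posRoots, x γ :=
  calc _ < ∑ γ ∈ D.posRoots, |x (w γ)| :=
        Finset.sum_lt_sum (fun _ _ => le_abs_self _) ⟨α, hα, by
          rw [hwα, map_neg, abs_neg, abs_of_pos hxα]; linarith⟩
    _ = ∑ γ ∈ D.posRoots, |x γ| := sum_posRoots_abs_comp hD hw x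
    _ = _ := Finset.sum_congr rfl fun γ hγ => abs_of_nonneg (hx γ hγ)

end Data

/-- The events met along a path: passing a matter wall `ω = n + κ` (left) or a root wall
`α = j` (right). -/
abbrev Event (ι : Type*) := (Σ _ : ι → ℤ, ℤ) ⊕ (Σ _ : ι → ℤ, ℤ)

/-- The time at which an event takes place along the path `t ↦ t·lam + y`. -/
def eventTime (lam : ι → ℤ) (y : (ι → ℤ) →+ ℝ) (κ : ℝ) : Event ι → ℝ
  | Sum.inl r => (r.2 + κ - y r.1) / pairZ r.1 lam
  | Sum.inr r => (r.2 - y r.1) / pairZ r.1 lam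

namespace Data

/-- The events on the path from a small vector to `lam`. -/
def events (D : Data ι) (lam : ι → ℤ) : Finset (Event ι) :=
  (D.Φpos.sigma fun ω => Finset.Ico 0 (pairZ ω lam)).disjSum
    (D.posRoots.sigma fun α => Finset.Ico 1 (pairZ α lam))

/-- A generic path `t ↦ t·lam + y`. -/
structure GenericPath (D : Data ι) where
  lam : ι → ℤ
  lam_pos : ∀ i, 0 < lam i
  y : (ι → ℤ) →+ ℝ
  y_small : ∀ γ, γ ∈ D.Φ ∨ γ ∈ D.roots → |y γ| < 1 / 4
  y_nonpos : ∀ α ∈ D.posRoots, y α ≤ 0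
  κ : ℝ
  le_κ : 1 / 4 ≤ κ
  κ_le : κ ≤ 3 / 4
  time_ne : ∀ α j, Sum.inr ⟨α, j⟩ ∈ D.events lam → ∀ r ∈ D.events lam, r ≠ Sum.inr ⟨α, j⟩ →
    eventTime lam y κ r ≠ eventTime lam y κ (Sum.inr ⟨α, j⟩)

namespace GenericPath

variable {D : Data ι} (p : D.GenericPath)

/-- The time of an event. -/
abbrev time : Event ι → ℝ := eventTime p.lam p.y p.κ

/-- The point of the path at time `t`, as a functional. -/
def pt (t : ℝ) (γ : ι → ℤ) : ℝ := t * pairZ γ p.lam + p.y γ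

/-- The value of the sum of the positive roots at the point `η` seen from the path. -/
def level (s : ℝ) (v : LatAut ι) (η : ι → ℤ) : ℝ :=
  ∑ α ∈ D.posRoots, (p.pt s (v α) - pairZ (v α) η) +
    (1 - s) * ∑ α ∈ D.posRoots, (pairZ α p.lam : ℝ) - ∑ α ∈ D.posRoots, p.y α

/-- All coordinates of the point `(v, η)` have been dealt with. -/
def Good (S : Finset (Event ι)) (t : ℝ) (v : LatAut ι) (η : ι → ℤ) : Prop :=
  ∀ m, Sum.inl ⟨v (e m), pairZ (v (e m)) η⟩ ∈ S ∨
    (p.pt t (v (e m)) < pairZ (v (e m)) η + p.κ ∧ pairZ (v (e m)) p.lam ≤ pairZ (v (e m)) η)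

/-- The vanishing property propagated along the path. -/
def Vanish (ρ : ι → ℂ) (S : Finset (Event ι)) (Y : MvPolynomial ι ℂ) : Prop :=
  ∀ t, 0 ≤ t → t < 1 → (∀ r, Sum.inr r ∈ S → t < p.time (Sum.inr r)) →
    ∀ v ∈ D.W, ∀ η, p.Good S t v η →
      (pairZ D.ell η < pairZ D.ell p.lam ∨ (pairZ D.ell η = pairZ D.ell p.lam ∧
        ∀ s, t < s → s ≤ 1 → p.level s v η < 0)) → eval (actV v ρ + toV η) Y = 0

lemma inl_mem_events {ω : ι → ℤ} {n : ℤ} :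
    Sum.inl ⟨ω, n⟩ ∈ D.events p.lam ↔ ω ∈ D.Φpos ∧ 0 ≤ n ∧ n < pairZ ω p.lam := by
  simp [events]

lemma inr_mem_events {α : ι → ℤ} {j : ℤ} :
    Sum.inr ⟨α, j⟩ ∈ D.events p.lam ↔ α ∈ D.posRoots ∧ 1 ≤ j ∧ j < pairZ α p.lam := by
  simp [events]

lemma pairZ_lam_nonneg {γ : ι → ℤ} (hγ : ∀ i, 0 ≤ γ i) : 0 ≤ pairZ γ p.lam :=
  Finset.sum_nonneg fun i _ => mul_nonneg (hγ i) (p.lam_pos i).le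

lemma pairZ_lam_nonpos {γ : ι → ℤ} (hγ : ∀ i, γ i ≤ 0) : pairZ γ p.lam ≤ 0 :=
  Finset.sum_nonpos fun i _ => mul_nonpos_of_nonpos_of_nonneg (hγ i) (p.lam_pos i).le

lemma pairZ_lam_pos {γ : ι → ℤ} (hγ : ∀ i, 0 ≤ γ i) (h0 : γ ≠ 0) : 0 < pairZ γ p.lam := by
  obtain ⟨i, hi⟩ := Function.ne_iff.1 h0
  exact Finset.sum_pos' (fun i _ => mul_nonneg (hγ i) (p.lam_pos i).le)
    ⟨i, Finset.mem_univ i, mul_pos (lt_of_le_of_ne (hγ i) (Ne.symm hi)) (p.lam_pos i)⟩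

lemma le_or_event {t : ℝ} (ht0 : 0 ≤ t) (ht1 : t ≤ 1) {ω : ι → ℤ} (hω : ω ∈ D.Φ) {n : ℤ}
    (h : p.pt t ω < n + p.κ) :
    pairZ ω p.lam ≤ n ∨ (Sum.inl ⟨ω, n⟩ ∈ D.events p.lam ∧ t < p.time (Sum.inl ⟨ω, n⟩)) := by
  by_contra! hcon
  obtain ⟨h1, h2⟩ := hcon
  have hy := abs_lt.1 (p.y_small ω (Or.inl hω))
  have hκ := p.κ_le
  have h1' : (n : ℝ) + 1 ≤ pairZ ω p.lam := by exact_mod_cast h1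
  unfold pt at h
  rcases D.C3 ω hω with hpos | hneg
  · have hL : (0 : ℝ) ≤ pairZ ω p.lam := by exact_mod_cast p.pairZ_lam_nonneg hpos
    have hn : 0 ≤ n := by
      by_contra! hn
      have : (n : ℝ) + 1 ≤ 0 := by exact_mod_cast hn
      nlinarith [mul_nonneg ht0 hL]
    have h3 := h2 (p.inl_mem_events.2 ⟨Finset.mem_filter.2 ⟨hω, hpos⟩, hn, h1⟩)
    have hn' : (0 : ℝ) ≤ n := by exact_mod_cast hn
    have hL' : (0 : ℝ) < pairZ ω p.lam := by linarith
    simp only [time, eventTime] at h3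
    rw [div_le_iff₀ hL'] at h3
    linarith
  · have hL : (pairZ ω p.lam : ℝ) ≤ 0 := by exact_mod_cast p.pairZ_lam_nonpos hneg
    nlinarith

lemma good_events {t : ℝ} (ht0 : 0 ≤ t) (ht1 : t ≤ 1) {v : LatAut ι} (hv : v ∈ D.W)
    {η : ι → ℤ} {S : Finset (Event ι)}
    (hS : ∀ r ∈ D.events p.lam, t < p.time r → r ∈ S)
    (h : ∀ m, p.pt t (v (e m)) < pairZ (v (e m)) η + p.κ) : p.Good S t v η := fun m => by
  rcases p.le_or_event ht0 ht1 (D.Φ_stable hv (D.e_mem_Φ m)) (h m) with h1 | ⟨h1, h2⟩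
  · exact Or.inr ⟨h m, h1⟩
  · exact Or.inl (hS _ h1 h2)

lemma pt_lt_of_good {t t' : ℝ} (htt' : t ≤ t') (ht1 : t' < 1) {v : LatAut ι}
    (hv : v ∈ D.W) {η : ι → ℤ} {S : Finset (Event ι)} (hS : S ⊆ D.events p.lam)
    (hlt : ∀ r, Sum.inl r ∈ S → t' < p.time (Sum.inl r)) (h : p.Good S t v η) (m : ι) :
    p.pt t' (v (e m)) < pairZ (v (e m)) η + p.κ := by
  have hy := abs_lt.1 (p.y_small _ (Or.inl (D.Φ_stable hv (D.e_mem_Φ m))))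
  have hκ := p.le_κ
  unfold pt
  rcases h m with h1 | ⟨h1, h2⟩
  · have h3 := hlt _ h1
    obtain ⟨-, h4, h5⟩ := p.inl_mem_events.1 (hS h1)
    have hL : (0 : ℝ) < pairZ (v (e m)) p.lam := by exact_mod_cast h4.trans_lt h5
    simp only [time, eventTime] at h3
    rw [lt_div_iff₀ hL] at h3
    linarith
  · have h2' : (pairZ (v (e m)) p.lam : ℝ) ≤ pairZ (v (e m)) η := by exact_mod_cast h2
    unfold pt at h1
    rcases le_total (0 : ℝ) (pairZ (v (e m)) p.lam) with hL | hL <;> nlinarith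

lemma time_inr_mem {α : ι → ℤ} {j : ℤ} (h : Sum.inr ⟨α, j⟩ ∈ D.events p.lam) :
    0 ≤ p.time (Sum.inr ⟨α, j⟩) ∧ p.time (Sum.inr ⟨α, j⟩) < 1 ∧
      p.pt (p.time (Sum.inr ⟨α, j⟩)) α = j := by
  obtain ⟨h1, h2, h3⟩ := p.inr_mem_events.1 h
  have hy := abs_lt.1 (p.y_small _ (Or.inr (D.mem_posRoots.1 h1).1))
  have hL : (0 : ℝ) < pairZ α p.lam := by exact_mod_cast (by omega : 0 < pairZ α p.lam)
  have h2' : (1 : ℝ) ≤ j := by exact_mod_cast h2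
  have h3' : (j : ℝ) + 1 ≤ pairZ α p.lam := by exact_mod_cast h3
  simp only [time, eventTime, pt]
  refine ⟨div_nonneg (by linarith) hL.le, ?_, ?_⟩
  · rw [div_lt_one hL]; linarith
  · field_simp; ring

/-- The path point as an additive functional. -/
def lamHom : (ι → ℤ) →+ ℝ where
  toFun γ := pairZ γ p.lam
  map_zero' := by simp [pairZ_zero_left]
  map_add' a b := by simp [pairZ_add_left]

lemma lamHom_apply (γ : ι → ℤ) : p.lamHom γ = pairZ γ p.lam := rfl

lemma lamHom_nonneg {γ : ι → ℤ} (hγ : γ ∈ D.posRoots) : 0 ≤ p.lamHom γ := by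
  rw [lamHom_apply]
  exact_mod_cast p.pairZ_lam_nonneg (D.mem_posRoots.1 hγ).2

lemma level_sub (s t : ℝ) (v : LatAut ι) (η : ι → ℤ) :
    p.level s v η = p.level t v η +
      (s - t) * (∑ α ∈ D.posRoots, p.lamHom (v α) - ∑ α ∈ D.posRoots, p.lamHom α) := by
  simp only [level, pt, lamHom_apply, Finset.sum_sub_distrib, Finset.sum_add_distrib,
    ← Finset.mul_sum]
  ring

section Reflection

variable {α c : ι → ℤ} {w : LatAut ι} {j : ℤ} {t : ℝ}

lemma refl_frame (hc : pairZ α c = 2) (hwx : ∀ x, w x = reflMap α c x) (ht : p.pt t α = j)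
    (v : LatAut ι) (η γ : ι → ℤ) :
    p.pt t ((w * v) γ) - pairZ ((w * v) γ) (actDual w η + j • c) =
      p.pt t (v γ) - pairZ (v γ) η := by
  have h1 : pairZ (w (v γ)) (actDual w η) = pairZ (v γ) η := by
    rw [pairZ_actDual, LinearEquiv.symm_apply_apply]
  have h2 : pairZ (w (v γ)) c = -pairZ (v γ) c := by
    rw [hwx, reflMap, pairZ_sub_left, pairZ_smul_left, hc]; ring
  have h3 : p.pt t (w (v γ)) = p.pt t (v γ) - pairZ (v γ) c * j := by
    rw [← ht, hwx, reflMap]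
    simp only [pt, pairZ_sub_left, pairZ_smul_left, map_sub, map_zsmul]
    rw [zsmul_eq_mul]
    push_cast
    ring
  rw [LinearEquiv.mul_apply, pairZ_add_right, pairZ_smul_right, h1, h2, h3]
  push_cast
  ring

lemma refl_level (hc : pairZ α c = 2) (hwx : ∀ x, w x = reflMap α c x) (ht : p.pt t α = j)
    (v : LatAut ι) (η : ι → ℤ) :
    p.level t (w * v) (actDual w η + j • c) = p.level t v η := by
  simp only [level, p.refl_frame hc hwx ht]

lemma refl_point (hc : pairZ α c = 2) (hwx : ∀ x, w x = reflMap α c x) (ρ : ι → ℂ)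
    (v : LatAut ι) (η : ι → ℤ) :
    actV v ρ + toV η - (evalC α (actV v ρ + toV η) - j) • toV c =
      actV (w * v) ρ + toV (actDual w η + j • c) := by
  rw [toV_add, toV_smul, ← actV_toV, ← add_assoc, actV_mul, ← actV_add, actV_refl hc hwx,
    sub_smul]
  abel

end Reflection

lemma vanish_empty (hD : D.Coherent) (ρ : ι → ℂ) : p.Vanish ρ ∅ 1 := by
  intro t ht0 ht1 _ v hv η hgood hη
  exfalso
  have h1 : ∀ m, pairZ (v (e m)) p.lam ≤ pairZ (v (e m)) η := fun m =>
    ((hgood m).resolve_left (by simp)).2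
  have hsum : ∀ ξ : ι → ℤ, pairZ D.ell ξ = ∑ m, D.ell m * pairZ (v (e m)) ξ := fun ξ => by
    conv_lhs => rw [← D.C4 v hv, map_eq_sum v, pairZ_sum_left]
    simp only [pairZ_smul_left]
  have h2 : ∀ m ∈ Finset.univ, D.ell m * pairZ (v (e m)) p.lam ≤ D.ell m * pairZ (v (e m)) η :=
    fun m _ => mul_le_mul_of_nonneg_left (h1 m) (D.C6 m).le
  have h3 : pairZ D.ell p.lam ≤ pairZ D.ell η := by
    rw [hsum, hsum]; exact Finset.sum_le_sum h2
  obtain ⟨h4, h5⟩ := hη.resolve_left (not_lt.2 h3)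
  rw [hsum, hsum, eq_comm, Finset.sum_eq_sum_iff_of_le h2] at h4
  have h6 : ∀ γ, pairZ (v γ) p.lam = pairZ (v γ) η := fun γ => by
    rw [map_eq_sum v γ, pairZ_sum_left, pairZ_sum_left]
    refine Finset.sum_congr rfl fun m _ => ?_
    rw [pairZ_smul_left, pairZ_smul_left,
      mul_left_cancel₀ (D.C6 m).ne' (h4 m (Finset.mem_univ m))]
  have h7 := h5 1 ht1 le_rfl
  have h8 := le_sum_posRoots_comp hD hv p.y p.y_nonpos
  simp only [level, pt, h6] at h7
  simp at h7
  linarith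

lemma vanish_insert_inl {ρ : ι → ℂ} {k : (ι → ℤ) → ℂ} (hk : D.IsK ρ k)
    {S : Finset (Event ι)} {Y : MvPolynomial ι ℂ} (hY : p.Vanish ρ S Y) (ω : ι → ℤ) (n : ℤ) :
    p.Vanish ρ (insert (Sum.inl ⟨ω, n⟩) S) ((lin ω - C (k ω + n)) * Y) := by
  intro t ht0 ht1 hroot v hv η hgood hη
  rw [map_mul]
  by_cases hm : ∃ m, v (e m) = ω ∧ pairZ (v (e m)) η = n
  · obtain ⟨m, rfl, rfl⟩ := hm
    rw [map_sub, eval_lin, eval_C, evalC_vadd, evalC_actV, LinearEquiv.symm_apply_apply, evalC_e,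
      evalC_toV, D.k_apply hk hv, sub_self, zero_mul]
  · rw [hY t ht0 ht1 (fun r hr => hroot r (Finset.mem_insert_of_mem hr)) v hv η (fun m => ?_) hη,
      mul_zero]
    refine (hgood m).imp_left fun h => ?_
    rcases Finset.mem_insert.1 h with h | h
    · simp only [Sum.inl.injEq, Sigma.mk.injEq, heq_eq_eq] at h
      exact absurd ⟨m, h.1, h.2⟩ hm
    · exact h

lemma vanish_insert_inr (hD : D.Coherent) {ρ : ι → ℂ}
    (hni : ∀ γ ∈ D.roots, ∀ n : ℤ, evalC γ ρ ≠ n)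
    {S : Finset (Event ι)} {Y Z : MvPolynomial ι ℂ} (hY : p.Vanish ρ S Y) {α c : ι → ℤ} {j : ℤ}
    {w : LatAut ι} (hw : w ∈ D.W) (hc : pairZ α c = 2) (hwx : ∀ x, w x = reflMap α c x)
    (hr : Sum.inr ⟨α, j⟩ ∈ D.events p.lam) (hS : S ⊆ D.events p.lam)
    (hSup : ∀ r ∈ D.events p.lam, p.time (Sum.inr ⟨α, j⟩) < p.time r → r ∈ S)
    (hlt : ∀ r ∈ S, p.time (Sum.inr ⟨α, j⟩) < p.time r)
    (hZ : ∀ z, (evalC α z - j) * eval z Z =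
      eval z Y - eval (z - (evalC α z - j) • toV c) Y) :
    p.Vanish ρ (insert (Sum.inr ⟨α, j⟩) S) Z := by
  intro t ht0 ht1 hroot v hv η hgood hη
  have hα := (D.mem_posRoots.1 (p.inr_mem_events.1 hr).1).1
  have htt' := hroot _ (Finset.mem_insert_self _ _)
  obtain ⟨ht'0, ht'1, ht'⟩ := p.time_inr_mem hr
  set t' := p.time (Sum.inr ⟨α, j⟩) with ht'def
  have hgood' : p.Good S t v η := fun m => (hgood m).imp_left fun h => by simpa using h
  have hpt := p.pt_lt_of_good htt'.le ht'1 hv hS (fun r hr => hlt _ hr) hgood'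
  have hell : pairZ D.ell (actDual w η + j • c) = pairZ D.ell η := by
    rw [pairZ_add_right, pairZ_smul_right, D.ell_coroot hα hw hwx, D.ell_actDual hw]; ring
  have h1 : eval (actV v ρ + toV η) Y = 0 := by
    refine hY t' ht'0 ht'1 (fun r hr => hlt _ hr) v hv η
      (p.good_events ht'0 ht'1.le hv hSup hpt) (hη.imp_right fun h => ⟨h.1, fun s hs => ?_⟩)
    exact h.2 s (htt'.trans hs)
  have h2 : eval (actV (w * v) ρ + toV (actDual w η + j • c)) Y = 0 := by
    refine hY t' ht'0 ht'1 (fun r hr => hlt _ hr) _ (D.W.mul_mem hw hv) _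
      (p.good_events ht'0 ht'1.le (D.W.mul_mem hw hv) hSup fun m => ?_) ?_
    · have := p.refl_frame hc hwx ht' v η (e m)
      have := hpt m
      linarith
    · rw [hell]
      refine hη.imp_right fun h => ⟨h.1, fun s hs hs1 => ?_⟩
      have h3 := sum_posRoots_comp_le hD (D.W.mul_mem hw hv) p.lamHom fun γ hγ => p.lamHom_nonneg hγ
      rw [p.level_sub s t', p.refl_level hc hwx ht']
      have h4 := h.2 t' htt' ht'1.le
      nlinarith
  have h3 := hZ (actV v ρ + toV η)
  rw [refl_point hc hwx, h1, h2, sub_zero, mul_eq_zero] at h3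
  refine h3.resolve_left fun h => hni _ (D.roots_stable (D.W.inv_mem hv) hα) (j - pairZ α η) ?_
  rw [evalC_vadd, evalC_actV, evalC_toV] at h
  push_cast
  rw [LatAut.inv_apply_eq_symm]
  linear_combination h

lemma eval_insert_inr_ne_zero (hD : D.Coherent) {ρ : ι → ℂ}
    {S : Finset (Event ι)} {Y Z : MvPolynomial ι ℂ} (hY : p.Vanish ρ S Y) {α c : ι → ℤ} {j : ℤ}
    {w : LatAut ι} (hw : w ∈ D.W) (hc : pairZ α c = 2) (hwx : ∀ x, w x = reflMap α c x)
    (hr : Sum.inr ⟨α, j⟩ ∈ D.events p.lam)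
    (hSup : ∀ r ∈ D.events p.lam, p.time (Sum.inr ⟨α, j⟩) < p.time r → r ∈ S)
    (hlt : ∀ r ∈ S, p.time (Sum.inr ⟨α, j⟩) < p.time r)
    (hZ : ∀ z, (evalC α z - j) * eval z Z =
      eval z Y - eval (z - (evalC α z - j) • toV c) Y)
    (hne : eval (ρ + toV p.lam) Y ≠ 0) : eval (ρ + toV p.lam) Z ≠ 0 := by
  obtain ⟨ht'0, ht'1, ht'⟩ := p.time_inr_mem hr
  set t' := p.time (Sum.inr ⟨α, j⟩) with ht'def
  have hαpos := (p.inr_mem_events.1 hr).1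
  obtain ⟨hα, hα0⟩ := D.mem_posRoots.1 hαpos
  have h2 : eval (actV (w * 1) ρ + toV (actDual w p.lam + j • c)) Y = 0 := by
    refine hY t' ht'0 ht'1 (fun r hr => hlt _ hr) _ (D.W.mul_mem hw D.W.one_mem) _
      (p.good_events ht'0 ht'1.le (D.W.mul_mem hw D.W.one_mem) hSup fun m => ?_)
      (Or.inr ⟨?_, fun s hs hs1 => ?_⟩)
    · have h3 := p.refl_frame hc hwx ht' 1 p.lam (e m)
      have h4 : p.pt t' ((1 : LatAut ι) (e m)) - pairZ ((1 : LatAut ι) (e m)) p.lam < p.κ := by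
        change p.pt t' (e m) - pairZ (e m) p.lam < p.κ
        have hy := abs_lt.1 (p.y_small _ (Or.inl (D.e_mem_Φ m)))
        have hL : (0 : ℝ) < p.lam m := by exact_mod_cast p.lam_pos m
        have := p.le_κ
        rw [pt, pairZ_e_left]
        nlinarith
      linarith
    · rw [pairZ_add_right, pairZ_smul_right, D.ell_coroot hα hw hwx, D.ell_actDual hw]; ring
    · have h3 := sum_posRoots_refl_lt hD hw p.lamHom (fun γ hγ => p.lamHom_nonneg hγ) hαpos
        (by rw [lamHom_apply]; exact_mod_cast p.pairZ_lam_pos hα0 (D.ne_zero_of_mem_roots hα))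
        (by rw [hwx, reflMap, hc]; module)
      rw [p.level_sub s t', p.refl_level hc hwx ht']
      have h4 : p.level t' 1 p.lam = 0 := by
        simp only [level, pt, LinearEquiv.coe_one, id_eq, Finset.sum_sub_distrib,
          Finset.sum_add_distrib, ← Finset.mul_sum]
        ring
      rw [h4, mul_one]
      nlinarith
  have h3 := hZ (ρ + toV p.lam)
  have h5 := refl_point (j := j) hc hwx ρ 1 p.lam
  rw [actV_one] at h5
  rw [h5, h2, sub_zero] at h3
  exact fun h => hne (by rw [← h3, h, mul_zero])

/-- The sign of an event: matter events raise the degree, root events lower it. -/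
def sgn : Event ι → ℤ
  | Sum.inl _ => 1
  | Sum.inr _ => -1

lemma exists_poly_of_upper (hD : D.Coherent) {ρ : ι → ℂ} {k : (ι → ℤ) → ℂ} (hk : D.IsK ρ k)
    (hni : ∀ γ ∈ D.roots, ∀ n : ℤ, evalC γ ρ ≠ n)
    (hρk : ∀ ω ∈ D.Φpos, ∀ n : ℤ, 0 < n → evalC ω ρ - k ω + n ≠ 0)
    (S : Finset (Event ι)) :
    S ⊆ D.events p.lam → (∀ r' ∈ S, ∀ r ∈ D.events p.lam, p.time r' < p.time r → r ∈ S) →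
    ∃ Y : MvPolynomial ι ℂ, (Y.totalDegree : ℤ) ≤ ∑ r ∈ S, sgn r ∧ p.Vanish ρ S Y ∧
      eval (ρ + toV p.lam) Y ≠ 0 := by
  induction S using Finset.induction_on_min_value p.time with
  | empty =>
    intro _ _
    exact ⟨1, by simp, p.vanish_empty hD ρ, by simp⟩
  | insert r S hrS hmin ih =>
    intro hsub hup
    have hsubS : S ⊆ D.events p.lam := (Finset.subset_insert _ _).trans hsub
    have hr : r ∈ D.events p.lam := hsub (Finset.mem_insert_self _ _)
    have hSup : ∀ r' ∈ D.events p.lam, p.time r < p.time r' → r' ∈ S := fun r' hr' hlt =>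
      (Finset.mem_insert.1 (hup r (Finset.mem_insert_self _ _) r' hr' hlt)).resolve_left
        (by rintro rfl; exact lt_irrefl _ hlt)
    obtain ⟨Y, hYdeg, hYv, hYne⟩ := ih hsubS fun r' hr' r'' hr'' hlt =>
      hSup r'' hr'' ((hmin r' hr').trans_lt hlt)
    rw [Finset.sum_insert hrS]
    rcases r with ⟨ω, n⟩ | ⟨α, j⟩
    · refine ⟨(lin ω - C (k ω + n)) * Y, ?_, p.vanish_insert_inl hk hYv ω n, ?_⟩
      · have h1 := totalDegree_mul (lin ω - C (k ω + n)) Y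
        have h2 := totalDegree_lin_sub_C_le ω (k ω + n)
        change _ ≤ 1 + _
        omega
      · obtain ⟨h1, h2, h3⟩ := p.inl_mem_events.1 hr
        rw [map_mul, map_sub, eval_lin, eval_C, evalC_vadd, evalC_toV]
        refine mul_ne_zero ?_ hYne
        have := hρk ω h1 (pairZ ω p.lam - n) (by omega)
        push_cast at this
        intro h
        exact this (by linear_combination h)
    · obtain ⟨hαpos, -, -⟩ := p.inr_mem_events.1 hr
      have hα := (D.mem_posRoots.1 hαpos).1
      obtain ⟨c, hc, w, hw, hwx⟩ := D.exists_coroot hα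
      obtain ⟨Z, hZdeg, hZ⟩ := exists_divided_difference (D.ne_zero_of_mem_roots hα) c (j : ℂ) Y
      have hlt : ∀ r' ∈ S, p.time (Sum.inr ⟨α, j⟩) < p.time r' := fun r' hr' =>
        lt_of_le_of_ne (hmin r' hr') fun h =>
          p.time_ne α j hr r' (hsubS hr') (fun h' => hrS (h' ▸ hr')) h.symm
      have hZne := p.eval_insert_inr_ne_zero hD hYv hw hc hwx hr hSup hlt hZ hYne
      refine ⟨Z, ?_, p.vanish_insert_inr hD hni hYv hw hc hwx hr hsubS hSup hlt hZ, hZne⟩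
      have := hZdeg (by rintro rfl; simp at hZne)
      change _ ≤ -1 + _
      omega

lemma exists_poly (hD : D.Coherent) {ρ : ι → ℂ} {k : (ι → ℤ) → ℂ} (hk : D.IsK ρ k)
    (hni : ∀ γ ∈ D.roots, ∀ n : ℤ, evalC γ ρ ≠ n)
    (hρk : ∀ ω ∈ D.Φpos, ∀ n : ℤ, 0 < n → evalC ω ρ - k ω + n ≠ 0) :
    ∃ Y : MvPolynomial ι ℂ, (Y.totalDegree : ℤ) ≤ ∑ ω ∈ D.Φpos, pairZ ω p.lam -
        ∑ α ∈ D.posRoots, (pairZ α p.lam - 1) ∧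
      (∀ v ∈ D.W, ∀ ν ∈ LamPlus, pairZ D.ell ν < pairZ D.ell p.lam →
        eval (actV v (ρ + toV ν)) Y = 0) ∧
      eval (ρ + toV p.lam) Y ≠ 0 := by
  obtain ⟨Y, h1, h2, h3⟩ := p.exists_poly_of_upper hD hk hni hρk (D.events p.lam)
    (Finset.Subset.refl _) (fun _ _ r hr _ => hr)
  refine ⟨Y, h1.trans_eq ?_, fun v hv ν hν hlt => ?_, h3⟩
  · simp only [events, Finset.sum_disjSum, sgn, Finset.sum_const, Finset.card_sigma,
      Int.card_Ico, nsmul_eq_mul, mul_one, mul_neg, ← sub_eq_add_neg, Nat.cast_sum]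
    congr 1
    · refine Finset.sum_congr rfl fun ω hω => ?_
      have := p.pairZ_lam_nonneg (Finset.mem_filter.1 hω).2
      omega
    · refine Finset.sum_congr rfl fun α hα => ?_
      obtain ⟨hα1, hα2⟩ := D.mem_posRoots.1 hα
      have := p.pairZ_lam_pos hα2 (D.ne_zero_of_mem_roots hα1)
      omega
  · rw [actV_add, actV_toV]
    refine h2 0 le_rfl one_pos (fun r hr => ?_) v hv _
      (p.good_events le_rfl zero_le_one hv (fun r hr _ => hr) fun m => ?_)
      (Or.inl (by rwa [D.ell_actDual hv]))
    · obtain ⟨h4, h5, h6⟩ := p.inr_mem_events.1 hr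
      have hy := abs_lt.1 (p.y_small _ (Or.inr (D.mem_posRoots.1 h4).1))
      have hL : (0 : ℝ) < pairZ r.1 p.lam := by exact_mod_cast (by omega : 0 < pairZ r.1 p.lam)
      have h5' : (1 : ℝ) ≤ r.2 := by exact_mod_cast h5
      simp only [time, eventTime]
      exact div_pos (by linarith) hL
    · rw [pairZ_actDual, LinearEquiv.symm_apply_apply, pairZ_e_left, pt]
      have hy := abs_lt.1 (p.y_small _ (Or.inl (D.Φ_stable hv (D.e_mem_Φ m))))
      have hν' : (0 : ℝ) ≤ ν m := by exact_mod_cast hν m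
      have := p.le_κ
      linarith

end GenericPath

end Data

/-- A positive functional that does not vanish on finitely many given nonzero vectors. -/
lemma exists_generic_functional (F : Finset (ι → ℤ)) (hF : ∀ γ ∈ F, γ ≠ 0) :
    ∃ U : (ι → ℤ) →+ ℝ, (∀ γ ∈ F, U γ ≠ 0) ∧ ∀ γ : ι → ℤ, (∀ i, 0 ≤ γ i) → 0 ≤ U γ := by
  set idx := Fintype.equivFin ι with hidx
  set P : (ι → ℤ) → Polynomial ℝ := fun γ => ∑ i, Polynomial.monomial (idx i : ℕ) (γ i : ℝ) with hP
  have hcoeff : ∀ γ i, (P γ).coeff (idx i) = γ i := fun γ i => by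
    simp only [hP, Polynomial.finsetSum_coeff, Polynomial.coeff_monomial, Fin.val_inj,
      idx.apply_eq_iff_eq]
    simp
  have hne : (∏ γ ∈ F, P γ) ≠ 0 := Finset.prod_ne_zero_iff.2 fun γ hγ h0 => by
    refine hF γ hγ (funext fun i => ?_)
    have := hcoeff γ i
    rw [h0, Polynomial.coeff_zero] at this
    exact_mod_cast this.symm
  obtain ⟨s, hs0, hs⟩ := ((Set.Ioi_infinite (0 : ℝ)).sdiff
    (Polynomial.finite_setOfPred_isRoot hne)).nonempty
  refine ⟨⟨⟨fun γ => ∑ i, (γ i : ℝ) * s ^ (idx i : ℕ), by simp⟩, fun a b => by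
    simp [add_mul, Finset.sum_add_distrib]⟩, fun γ hγ h => hs ?_, fun γ hγ => ?_⟩
  · rw [Set.mem_ofPred_eq, Polynomial.IsRoot.def, Polynomial.eval_prod]
    refine Finset.prod_eq_zero hγ ?_
    simpa [hP, Polynomial.eval_finsetSum] using h
  · refine Finset.sum_nonneg fun i _ => mul_nonneg (by exact_mod_cast hγ i) (pow_nonneg ?_ _)
    exact (Set.mem_Ioi.1 hs0).le

namespace Data

variable {D : Data ι}

lemma eq_of_smul_eq_smul {α β : ι → ℤ} (hα : α ∈ D.roots) (hβ : β ∈ D.roots) {a b : ℤ}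
    (ha : 0 < a) (hb : 0 < b) (h : a • α = b • β) : α = β := by
  obtain ⟨g, a', b', hg, hcop, rfl, rfl⟩ : ∃ g a' b' : ℤ, 0 < g ∧ IsCoprime a' b' ∧
      a = a' * g ∧ b = b' * g := by
    obtain ⟨g, a', b', hg, h1, h2, h3⟩ := Int.exists_gcd_one' (Int.gcd_pos_of_ne_zero_left b ha.ne')
    exact ⟨g, a', b', by exact_mod_cast hg, Int.isCoprime_iff_gcd_eq_one.2 h1, h2, h3⟩
  have ha' : 0 < a' := pos_of_mul_pos_left ha hg.le
  have hb' : 0 < b' := pos_of_mul_pos_left hb hg.le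
  have h' : ∀ i, a' * α i = b' * β i := fun i => by
    have := congrFun h i
    simp only [Pi.smul_apply, smul_eq_mul] at this
    exact mul_right_cancel₀ hg.ne' (by linear_combination this)
  have hunit : ∀ {γ δ : ι → ℤ} {c d : ℤ}, γ ∈ D.roots → 0 < d → IsCoprime c d →
      (∀ i, c * γ i = d * δ i) → d = 1 := fun {γ δ c d} hγ hd hcd hi => by
    have hdvd : ∀ i, d ∣ γ i := fun i => hcd.symm.dvd_of_dvd_mul_left ⟨δ i, hi i⟩
    choose ε hε using hdvd
    have := Int.isUnit_iff.1 (D.roots_prim hγ (n := d) (β := ε) (funext fun i => by simp [hε i]))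
    omega
  have hb1 := hunit hα hb' hcop h'
  have ha1 := hunit hβ ha' hcop.symm (fun i => (h' i).symm)
  funext i
  simpa [ha1, hb1] using h' i

lemma exists_genericPath (lam : ι → ℤ) (hlam : ∀ i, 0 < lam i) :
    ∃ p : D.GenericPath, p.lam = lam := by
  have hposr : ∀ α ∈ D.posRoots, 0 < pairZ α lam := fun α hα => by
    obtain ⟨h1, h2⟩ := D.mem_posRoots.1 hα
    obtain ⟨i, hi⟩ := Function.ne_iff.1 (D.ne_zero_of_mem_roots h1)
    exact Finset.sum_pos' (fun i _ => mul_nonneg (h2 i) (hlam i).le)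
      ⟨i, Finset.mem_univ i, mul_pos (lt_of_le_of_ne (h2 i) (Ne.symm hi)) (hlam i)⟩
  set F : Finset (ι → ℤ) := ((D.posRoots ×ˢ D.posRoots).filter fun x => x.1 ≠ x.2).image
    fun x => pairZ x.2 lam • x.1 - pairZ x.1 lam • x.2 with hF
  obtain ⟨U, hU, hU0⟩ := exists_generic_functional F (by
    intro γ hγ h0
    obtain ⟨⟨α, β⟩, hx, rfl⟩ := Finset.mem_image.1 hγ
    obtain ⟨h1, h2⟩ := Finset.mem_filter.1 hx
    obtain ⟨hα, hβ⟩ := Finset.mem_product.1 h1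
    exact h2 (eq_of_smul_eq_smul (D.mem_posRoots.1 hα).1 (D.mem_posRoots.1 hβ).1
      (hposr β hβ) (hposr α hα) (sub_eq_zero.1 h0)))
  set B : ℝ := ∑ γ ∈ D.Φ ∪ D.roots, |U γ| with hB
  set H : ℝ := ∑ γ ∈ D.Φ ∪ D.roots, |(pairZ γ lam : ℝ)| with hH
  have hB0 : 0 ≤ B := Finset.sum_nonneg fun _ _ => abs_nonneg _
  have hH0 : 0 ≤ H := Finset.sum_nonneg fun _ _ => abs_nonneg _
  have hUB : ∀ γ, γ ∈ D.Φ ∨ γ ∈ D.roots → |U γ| ≤ B := fun γ hγ =>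
    Finset.single_le_sum (f := fun γ => |U γ|) (fun _ _ => abs_nonneg _) (Finset.mem_union.2 hγ)
  have hLH : ∀ γ, γ ∈ D.Φ ∨ γ ∈ D.roots → |(pairZ γ lam : ℝ)| ≤ H := fun γ hγ =>
    Finset.single_le_sum (f := fun γ => |(pairZ γ lam : ℝ)|) (fun _ _ => abs_nonneg _)
      (Finset.mem_union.2 hγ)
  set ε : ℝ := 1 / (8 * (B + 1) * (H + 1)) with hε
  have hε0 : 0 < ε := by positivity
  have hεBH : ε * ((B + 1) * (H + 1)) = 1 / 8 := by rw [hε]; field_simp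
  set y : (ι → ℤ) →+ ℝ := -((AddMonoidHom.mulLeft ε).comp U) with hy
  have hyU : ∀ γ, y γ = -(ε * U γ) := fun γ => rfl
  set T : Set ℝ := (fun x : Event ι × Event ι => match x with
    | (Sum.inl ω, Sum.inr α) =>
      (pairZ ω.1 lam : ℝ) * ((α.2 - y α.1) / pairZ α.1 lam) + y ω.1 - ω.2
    | _ => 0) '' ((D.events lam ×ˢ D.events lam : Finset _) : Set (Event ι × Event ι)) with hT
  have hTfin : T.Finite := (Finset.finite_toSet _).image _
  obtain ⟨κ, ⟨hκ1, hκ2⟩, hκT⟩ := ((Set.Icc_infinite (by norm_num : (1 / 4 : ℝ) < 3 / 4)).sdiff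
    hTfin).nonempty
  refine ⟨⟨lam, hlam, y, fun γ hγ => ?_, fun α hα => ?_, κ, hκ1, hκ2, ?_⟩, rfl⟩
  · have h1 := hUB γ hγ
    rw [hyU, abs_neg, abs_mul, abs_of_pos hε0]
    have h2 : |U γ| ≤ (B + 1) * (H + 1) := by nlinarith [mul_nonneg hB0 hH0]
    linarith [mul_le_mul_of_nonneg_left h2 hε0.le]
  · rw [hyU]
    have := hU0 α (D.mem_posRoots.1 hα).2
    nlinarith
  · intro α j hα r hr hne heq
    have hα' : α ∈ D.posRoots := by
      simp only [events, Finset.inr_mem_disjSum, Finset.mem_sigma] at hα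
      exact hα.1
    have hαL : (0 : ℝ) < pairZ α lam := by exact_mod_cast hposr α hα'
    rcases r with ⟨ω, n⟩ | ⟨β, m⟩
    · refine hκT ⟨(Sum.inl ⟨ω, n⟩, Sum.inr ⟨α, j⟩), ?_, ?_⟩
      · exact Finset.mem_coe.2 (Finset.mem_product.2 ⟨hr, hα⟩)
      · have hωL : (0 : ℝ) < pairZ ω lam := by
          simp only [events, Finset.inl_mem_disjSum, Finset.mem_sigma, Finset.mem_Ico] at hr
          exact_mod_cast hr.2.1.trans_lt hr.2.2
        simp only [eventTime] at heq
        change (pairZ ω lam : ℝ) * ((j - y α) / pairZ α lam) + y ω - n = κ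
        rw [← heq]
        field_simp
        ring
    · have hβ' : β ∈ D.posRoots := by
        simp only [events, Finset.inr_mem_disjSum, Finset.mem_sigma] at hr
        exact hr.1
      have hβL : (0 : ℝ) < pairZ β lam := by exact_mod_cast hposr β hβ'
      simp only [eventTime] at heq
      rw [div_eq_div_iff hβL.ne' hαL.ne', hyU, hyU] at heq
      by_cases hαβ : α = β
      · subst hαβ
        refine hne ?_
        have h1 := mul_right_cancel₀ hαL.ne' heq
        have h2 : (m : ℝ) = j := by linarith
        rw [Int.cast_injective h2]
      · have hα1 := (D.mem_posRoots.1 hα').1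
        have hβ1 := (D.mem_posRoots.1 hβ').1
        have hne0 := hU _ (Finset.mem_image.2 ⟨(α, β), Finset.mem_filter.2
          ⟨Finset.mem_product.2 ⟨hα', hβ'⟩, hαβ⟩, rfl⟩)
        simp only [map_sub, map_zsmul] at hne0
        rw [zsmul_eq_mul, zsmul_eq_mul] at hne0
        have hpint : ((m * pairZ α lam - j * pairZ β lam : ℤ) : ℝ) =
            ε * (pairZ β lam * U α - pairZ α lam * U β) := by
          push_cast
          linear_combination heq
        have hbd : |ε * (pairZ β lam * U α - pairZ α lam * U β)| < 1 := by
          rw [abs_mul, abs_of_pos hε0]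
          have h1 : |(pairZ β lam : ℝ) * U α - pairZ α lam * U β| ≤ H * B + H * B :=
            (abs_sub _ _).trans (by
              rw [abs_mul, abs_mul]
              exact add_le_add
                (mul_le_mul (hLH β (Or.inr hβ1)) (hUB α (Or.inr hα1)) (abs_nonneg _) hH0)
                (mul_le_mul (hLH α (Or.inr hα1)) (hUB β (Or.inr hβ1)) (abs_nonneg _) hH0))
          have h2 : H * B + H * B ≤ 2 * ((B + 1) * (H + 1)) := by nlinarith
          linarith [mul_le_mul_of_nonneg_left (h1.trans h2) hε0.le]
        rw [← hpint] at hbd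
        have hz : m * pairZ α lam - j * pairZ β lam = 0 :=
          Int.abs_lt_one_iff.1 (by exact_mod_cast hbd)
        rw [hz, Int.cast_zero, eq_comm, mul_eq_zero] at hpint
        exact hpint.elim hε0.ne' hne0

end Data

namespace Data

variable {D : Data ι}

lemma exists_generic_shift (hD : D.Coherent) {ρ : ι → ℂ} {k : (ι → ℤ) → ℂ} (hk : D.IsK ρ k)
    (N : ℕ) (hinj : Function.Injective (D.evalMap ρ N))
    (hsurj : Function.Surjective (D.evalMap ρ N)) :
    ∃ (ρ₁ : ι → ℂ) (k₁ : (ι → ℤ) → ℂ), D.IsK ρ₁ k₁ ∧ Function.Injective (D.evalMap ρ₁ N) ∧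
      (∀ γ ∈ D.roots, ∀ n : ℤ, evalC γ ρ₁ ≠ n) ∧
      (∀ ω ∈ D.Φpos, ∀ n : ℤ, 0 < n → evalC ω ρ₁ - k₁ ω + n ≠ 0) := by
  have hev : ∀ (γ : ι → ℤ) (t : ℂ),
      evalC γ (fun i => ρ i + t) = evalC γ ρ + t * (∑ i, γ i : ℤ) := fun γ t => by
    simp only [evalC, mul_add, Finset.sum_add_distrib, Int.cast_sum, Finset.mul_sum]
    exact congrArg _ (Finset.sum_congr rfl fun _ _ => mul_comm _ _)
  have hlin : ∀ a b : ℂ, b ≠ 0 → {t : ℂ | a + t * b = 0}.Countable := fun a b hb => by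
    refine Set.Countable.mono (fun t ht => ?_) (Set.countable_singleton (-a / b))
    rw [Set.mem_singleton_iff, eq_div_iff hb]
    exact eq_neg_of_add_eq_zero_right ht
  have hht : ∀ γ : ι → ℤ, (∀ i, 0 ≤ γ i) → γ ≠ 0 → 0 < ∑ i, γ i := fun γ h0 hne => by
    obtain ⟨i, hi⟩ := Function.ne_iff.1 hne
    exact Finset.sum_pos' (fun i _ => h0 i)
      ⟨i, Finset.mem_univ i, lt_of_le_of_ne (h0 i) (Ne.symm hi)⟩
  have h1 := (evalMap_injective_shift D N hinj hsurj).countable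
  have h2 : (⋃ γ ∈ D.roots, ⋃ n : ℤ, {t : ℂ | evalC γ (fun i => ρ i + t) = n}).Countable := by
    refine D.roots.countable_toSet.biUnion fun γ hγ => Set.countable_iUnion fun n => ?_
    have hne : ((∑ i, γ i : ℤ) : ℂ) ≠ 0 := by
      rw [Int.cast_ne_zero]
      have hγ0 := D.ne_zero_of_mem_roots hγ
      rcases hD γ hγ with h | h
      · exact (hht γ h hγ0).ne'
      · have := hht (-γ) (fun i => by simpa using h i) (by simpa using hγ0)
        simp only [Pi.neg_apply, Finset.sum_neg_distrib] at this
        omega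
    refine (hlin (evalC γ ρ - n) _ hne).mono fun t ht => ?_
    rw [Set.mem_ofPred_eq, hev] at ht
    rw [Set.mem_ofPred_eq]
    linear_combination ht
  have h3 : (⋃ ω ∈ D.Φpos, ⋃ n : {n : ℤ // 0 < n},
      {t : ℂ | evalC ω (fun i => ρ i + t) - (k ω + t) + (n.1 : ℂ) = 0}).Countable := by
    refine D.Φpos.countable_toSet.biUnion fun ω hω => Set.countable_iUnion fun n => ?_
    obtain ⟨hωΦ, hω0⟩ := Finset.mem_filter.1 hω
    have hωne : ω ≠ 0 := by
      obtain ⟨w, -, i, rfl⟩ := (D.Φ_spec ω).1 hωΦ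
      intro h
      have h0 : e i = 0 := w.map_eq_zero_iff.1 h
      have := congrFun h0 i
      simp [e_apply] at this
    by_cases hone : ∑ i, ω i = 1
    · obtain ⟨m, hm⟩ := Function.ne_iff.1 hωne
      have hm1 : 1 ≤ ω m := by have := hω0 m; have : ω m ≠ 0 := hm; omega
      have hωe : ω = e m := by
        rw [← Finset.add_sum_erase _ _ (Finset.mem_univ m)] at hone
        have hs : 0 ≤ ∑ i ∈ Finset.univ.erase m, ω i := Finset.sum_nonneg fun i _ => hω0 i
        have hz : ∑ i ∈ Finset.univ.erase m, ω i = 0 := by omega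
        funext i
        rw [e_apply]
        split_ifs with him
        · subst him; omega
        · exact (Finset.sum_eq_zero_iff_of_nonneg fun i _ => hω0 i).1 hz i
            (Finset.mem_erase.2 ⟨him, Finset.mem_univ i⟩)
      have hkm : k (e m) = ρ m := by simpa using D.k_apply hk D.W.one_mem m
      convert Set.countable_empty
      refine Set.eq_empty_iff_forall_notMem.2 fun t ht => ?_
      rw [Set.mem_ofPred_eq, hωe, evalC_e, hkm] at ht
      have : (n.1 : ℂ) = 0 := by linear_combination ht
      exact n.2.ne' (by exact_mod_cast this)
    · refine (hlin (evalC ω ρ - k ω + n.1) ((∑ i, ω i : ℤ) - 1 : ℂ) ?_).mono fun t ht => ?_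
      · rw [sub_ne_zero]; exact_mod_cast hone
      · rw [Set.mem_ofPred_eq, hev] at ht
        rw [Set.mem_ofPred_eq]
        linear_combination ht
  obtain ⟨t, ht⟩ := Set.nonempty_compl.2 fun hall =>
    not_countable_complex (hall ▸ h1.union (h2.union h3))
  rw [Set.mem_compl_iff] at ht
  simp only [Set.mem_union, not_or, Set.mem_iUnion, not_exists, Set.mem_ofPred_eq, not_not] at ht
  exact ⟨fun i => ρ i + t, fun ω => k ω + t, fun ω i hi => congrArg (· + t) (hk ω i hi), ht.1, ht.2.1,
    fun ω hω n hn => ht.2.2 ω hω ⟨n, hn⟩⟩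

/-- Symmetrization of a polynomial with a prescribed nonzero value. -/
lemma exists_symmetrization (Y : MvPolynomial ι ℂ) (P : ι → ℂ) (hY : eval P Y ≠ 0) :
    ∃ Z : MvPolynomial ι ℂ, D.WInv Z ∧
      Z.totalDegree ≤ Y.totalDegree + D.W_finite.toFinset.card ∧ eval P Z ≠ 0 ∧
      ∀ z, (∀ w ∈ D.W, eval (actV w z) Y = 0) → eval z Z = 0 := by
  set G := D.W_finite.toFinset with hG
  have hmem : ∀ w, w ∈ G ↔ w ∈ D.W := fun w => by simp [hG]
  have hsep : ∀ w : LatAut ι, ∃ q : MvPolynomial ι ℂ, q.totalDegree ≤ 1 ∧ eval P q ≠ 0 ∧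
      (actV w P ≠ P → eval (actV w P) q = 0) := fun w => by
    by_cases h : actV w P = P
    · exact ⟨1, by simp, by simp, fun h' => absurd h h'⟩
    · obtain ⟨i, hi⟩ := Function.ne_iff.1 h
      refine ⟨X i - C (actV w P i), (totalDegree_sub _ _).trans (by simp), ?_, by simp⟩
      rw [map_sub, eval_X, eval_C]
      exact sub_ne_zero.2 (Ne.symm hi)
  choose q hq1 hq2 hq3 using hsep
  set Q := Y * ∏ w ∈ G, q w with hQ
  have hQdeg : Q.totalDegree ≤ Y.totalDegree + G.card := by
    refine (totalDegree_mul _ _).trans (Nat.add_le_add_left ?_ _)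
    refine (totalDegree_finsetProd _ _).trans ((Finset.sum_le_card_nsmul _ _ 1 fun w _ => hq1 w).trans ?_)
    simp
  have hQP : eval P Q ≠ 0 := by
    rw [hQ, map_mul, map_prod]
    exact mul_ne_zero hY (Finset.prod_ne_zero_iff.2 fun w _ => hq2 w)
  have hQw : ∀ w ∈ G, eval (actV w P) Q = if actV w P = P then eval P Q else 0 := fun w hw => by
    split_ifs with h
    · rw [h]
    · rw [hQ, map_mul, map_prod, Finset.prod_eq_zero hw (hq3 w h), mul_zero]
  refine ⟨∑ w ∈ G, actP w Q, fun v hv z => ?_, ?_, ?_, fun z hz => ?_⟩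
  · simp only [map_sum, eval_actP, ← actV_mul]
    refine Finset.sum_bij' (fun w _ => w * v) (fun w _ => w * v⁻¹)
      (fun w hw => (hmem _).2 (D.W.mul_mem ((hmem _).1 hw) hv))
      (fun w hw => (hmem _).2 (D.W.mul_mem ((hmem _).1 hw) (D.W.inv_mem hv)))
      (by simp) (by simp) (by simp)
  · exact (totalDegree_finsetSum_le fun w _ => totalDegree_actP_le w Q).trans hQdeg
  · simp only [map_sum, eval_actP]
    rw [Finset.sum_congr rfl hQw, ← Finset.sum_filter, Finset.sum_const, nsmul_eq_mul]
    refine mul_ne_zero (Nat.cast_ne_zero.2 (Finset.card_ne_zero_of_mem (a := 1) ?_)) hQP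
    exact Finset.mem_filter.2 ⟨(hmem _).2 D.W.one_mem, actV_one P⟩
  · rw [map_sum]
    refine Finset.sum_eq_zero fun w hw => ?_
    rw [eval_actP, hQ, map_mul, hz w ((hmem _).1 hw), zero_mul]

/-- The set of roots is stable under `W`. -/
theorem roots_subset_Δ (hC0 : D.C0) : D.roots ⊆ D.Δ := by
  obtain ⟨ρ', hρ', -, -, huniq⟩ := hC0
  have hcap : ∀ lam ∈ LamPlus, ∃ p, D.CapelliAt ρ' lam p := fun lam hlam => by
    obtain ⟨p, ⟨h1, h2, h3⟩, -⟩ := huniq lam hlam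
    exact ⟨p, h1, by rw [h2, Int.toNat_of_nonneg (D.pairZ_ell_nonneg hlam)], h3⟩
  have hD : D.Coherent := fun γ hγ => D.roots_coherent hρ' hcap hγ
  obtain ⟨k', hk'⟩ := D.exists_isK hρ'
  suffices hpos : D.posRoots ⊆ D.Δ by
    intro γ hγ
    rcases hD γ hγ with h | h
    · exact hpos (D.mem_posRoots.2 ⟨hγ, h⟩)
    · have := D.Δ_neg _ (hpos (D.mem_posRoots.2 ⟨D.roots_neg hγ, fun i => by simpa using h i⟩))
      rwa [neg_neg] at this
  intro β hβ
  by_contra hβΔ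
  obtain ⟨hβr, hβ0⟩ := D.mem_posRoots.1 hβ
  set K : ℤ := D.posRoots.card + D.W_finite.toFinset.card + 1 with hK
  have hK0 : 0 < K := by positivity
  obtain ⟨p, hp⟩ := D.exists_genericPath (fun _ : ι => K) (fun _ => hK0)
  have hβK : K ≤ pairZ β p.lam := by
    obtain ⟨i, hi⟩ := Function.ne_iff.1 (D.ne_zero_of_mem_roots hβr)
    have h1 : 1 ≤ β i := by have := hβ0 i; have : β i ≠ 0 := hi; omega
    rw [hp]
    refine le_trans ?_ (Finset.single_le_sum (f := fun i => β i * K)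
      (fun j _ => mul_nonneg (hβ0 j) hK0.le) (Finset.mem_univ i))
    nlinarith
  have hC5 : ∑ ω ∈ D.Φpos, pairZ ω p.lam - ∑ α ∈ D.Δpos, pairZ α p.lam = pairZ D.ell p.lam := by
    rw [← pairZ_sum_left, ← pairZ_sum_left, ← pairZ_sub_left]
    exact congrArg (pairZ · p.lam) D.C5
  have hsub : insert β D.Δpos ⊆ D.posRoots := by
    refine Finset.insert_subset hβ fun α hα => ?_
    obtain ⟨h1, h2⟩ := Finset.mem_filter.1 hα
    exact D.mem_posRoots.2 ⟨D.Δ_subset_roots h1, h2⟩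
  have hle : ∑ α ∈ insert β D.Δpos, pairZ α p.lam ≤ ∑ α ∈ D.posRoots, pairZ α p.lam :=
    Finset.sum_le_sum_of_subset_of_nonneg hsub fun α hα _ =>
      p.pairZ_lam_nonneg (D.mem_posRoots.1 hα).2
  rw [Finset.sum_insert (show β ∉ D.Δpos from fun h => hβΔ (Finset.mem_filter.1 h).1)] at hle
  set N : ℕ := (pairZ D.ell p.lam - 1).toNat with hN
  obtain ⟨ρ, k, hk, hinj, hni, hρk⟩ := exists_generic_shift hD hk' N
    (D.evalMap_injective_of_unique N huniq) (D.evalMap_surjective_of_capelli hcap)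
  obtain ⟨Y, hYdeg, hYv, hYne⟩ := p.exists_poly hD hk hni hρk
  obtain ⟨Z, hZinv, hZdeg, hZne, hZv⟩ := exists_symmetrization (D := D) Y _ hYne
  rw [Finset.sum_sub_distrib, Finset.sum_const, nsmul_eq_mul, mul_one] at hYdeg
  refine hZne ?_
  rw [D.eq_zero_of_injective hinj hZinv (by omega) fun ν hν hlt => hZv _ fun w hw =>
    hYv w hw ν hν (by omega), map_zero]

lemma Δ_stable (hC0 : D.C0) {w : LatAut ι} (hw : w ∈ D.W) {α : ι → ℤ} (hα : α ∈ D.Δ) :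
    w α ∈ D.Δ :=
  roots_subset_Δ hC0 (D.roots_stable hw (D.Δ_subset_roots hα))

end Data

section Shift

/-- The polynomial `z ↦ p (z - η)`. -/
def shiftP (η : ι → ℤ) (p : MvPolynomial ι ℂ) : MvPolynomial ι ℂ :=
  bind₁ (fun i => X i - C (η i : ℂ)) p

lemma eval_shiftP (η : ι → ℤ) (p : MvPolynomial ι ℂ) (z : ι → ℂ) :
    eval z (shiftP η p) = eval (z - toV η) p := by
  rw [shiftP, eval_bind₁']
  congr 2
  funext i
  simp [toV]

lemma totalDegree_shiftP_le (η : ι → ℤ) (p : MvPolynomial ι ℂ) :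
    (shiftP η p).totalDegree ≤ p.totalDegree :=
  totalDegree_bind₁_le _ (fun i => (totalDegree_sub _ _).trans
    (max_le (by simp [totalDegree_X]) (by rw [totalDegree_C]; exact Nat.zero_le _))) p

/-- `p` has degree at most `n`, and shifting `p` by `η` only affects the terms of degree
less than `n`. -/
def ShiftDeg (η : ι → ℤ) (p : MvPolynomial ι ℂ) (n : ℕ) : Prop :=
  p.totalDegree ≤ n ∧ (shiftP η p - p = 0 ∨ (shiftP η p - p).totalDegree + 1 ≤ n)

lemma ShiftDeg.mono {η : ι → ℤ} {p : MvPolynomial ι ℂ} {m n : ℕ} (h : ShiftDeg η p m)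
    (hmn : m ≤ n) : ShiftDeg η p n :=
  ⟨h.1.trans hmn, h.2.imp_right fun h => h.trans hmn⟩

lemma ShiftDeg.mul {η : ι → ℤ} {p q : MvPolynomial ι ℂ} {m n : ℕ} (hp : ShiftDeg η p m)
    (hq : ShiftDeg η q n) : ShiftDeg η (p * q) (m + n) := by
  refine ⟨(totalDegree_mul p q).trans (Nat.add_le_add hp.1 hq.1), ?_⟩
  have h : shiftP η (p * q) - p * q =
      (shiftP η p - p) * shiftP η q + p * (shiftP η q - q) := by
    rw [show shiftP η (p * q) = shiftP η p * shiftP η q from map_mul _ _ _]; ring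
  have h1 := totalDegree_mul (shiftP η p - p) (shiftP η q)
  have h2 := totalDegree_mul p (shiftP η q - q)
  have h3 := (totalDegree_shiftP_le η q).trans hq.1
  have h4 := totalDegree_add ((shiftP η p - p) * shiftP η q) (p * (shiftP η q - q))
  have hp1 := hp.1
  rw [h]
  rcases hp.2 with h0 | h0 <;> rcases hq.2 with h0' | h0'
  · left; rw [h0, h0']; ring
  · right; rw [h0, zero_mul, zero_add]; omega
  · right; rw [h0', mul_zero, add_zero]; omega
  · right
    rcases le_max_iff.1 h4 with h5 | h5 <;> omega

lemma ShiftDeg.sum {η : ι → ℤ} {κ : Type*} (s : Finset κ) (g : κ → MvPolynomial ι ℂ) {n : ℕ}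
    (hg : ∀ j ∈ s, ShiftDeg η (g j) n) : ShiftDeg η (∑ j ∈ s, g j) n := by
  refine ⟨totalDegree_finsetSum_le fun j hj => (hg j hj).1, ?_⟩
  have h : shiftP η (∑ j ∈ s, g j) - ∑ j ∈ s, g j = ∑ j ∈ s, (shiftP η (g j) - g j) := by
    rw [Finset.sum_sub_distrib, ← show shiftP η (∑ j ∈ s, g j) = ∑ j ∈ s, shiftP η (g j) from
      map_sum _ _ _]
  rw [h]
  by_cases h0 : ∑ j ∈ s, (shiftP η (g j) - g j) = 0
  · exact Or.inl h0
  obtain ⟨j, hj, hj0⟩ := Finset.exists_ne_zero_of_sum_ne_zero h0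
  have hn := (hg j hj).2.resolve_left hj0
  have h1 : (∑ j ∈ s, (shiftP η (g j) - g j)).totalDegree ≤ n - 1 := by
    refine totalDegree_finsetSum_le fun i hi => ?_
    rcases (hg i hi).2 with h2 | h2
    · rw [h2]; simp
    · omega
  right; omega

lemma shiftDeg_C (η : ι → ℤ) (c : ℂ) : ShiftDeg η (C c) 0 :=
  ⟨by simp, Or.inl (by simp [shiftP])⟩

lemma shiftDeg_X_pow (η : ι → ℤ) (i : ι) (n : ℕ) : ShiftDeg η (X i ^ n) n := by
  induction n with
  | zero => simpa using shiftDeg_C η 1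
  | succ n ih =>
    rw [pow_succ]
    refine ih.mul ⟨by simp, ?_⟩
    rw [show shiftP η (X i) - X i = -C (η i : ℂ) by simp [shiftP]]
    right; rw [totalDegree_neg, totalDegree_C]

lemma shiftDeg_prod (η : ι → ℤ) (m : ι →₀ ℕ) (s : Finset ι) :
    ShiftDeg η (∏ i ∈ s, X i ^ m i) (∑ i ∈ s, m i) := by
  induction s using Finset.induction_on with
  | empty => simpa using shiftDeg_C η 1
  | insert i s hi ih =>
    rw [Finset.prod_insert hi, Finset.sum_insert hi]
    exact (shiftDeg_X_pow η i _).mul ih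

lemma shiftDeg_totalDegree (η : ι → ℤ) (p : MvPolynomial ι ℂ) :
    ShiftDeg η p p.totalDegree := by
  suffices h : ShiftDeg η (∑ m ∈ p.support, monomial m (p.coeff m)) p.totalDegree by
    rwa [← p.as_sum] at h
  refine ShiftDeg.sum _ _ fun m hm => ?_
  rw [monomial_eq]
  have := ((shiftDeg_C η (p.coeff m)).mul (shiftDeg_prod η m m.support))
  rw [zero_add] at this
  exact this.mono (le_totalDegree hm)

lemma totalDegree_shiftP_sub_lt (η : ι → ℤ) (p : MvPolynomial ι ℂ) (h : shiftP η p - p ≠ 0) :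
    (shiftP η p - p).totalDegree + 1 ≤ p.totalDegree :=
  (shiftDeg_totalDegree η p).2.resolve_left h

end Shift

namespace Data

variable {D : Data ι}

lemma pairZ_Φ_Λ₁ {η : ι → ℤ} (hη : η ∈ D.Λ₁) {ω : ι → ℤ} (hω : ω ∈ D.Φ) :
    pairZ ω η = -1 ∨ pairZ ω η = 0 ∨ pairZ ω η = 1 := by
  obtain ⟨w, hw, i, hi, rfl⟩ := (D.Λ₁_spec η).1 hη
  rw [pairZ_actDual, pairZ_e_right]
  exact D.C7 i hi _ (Or.inr (D.Φ_stable_symm hw hω))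

/-- Transport of a filtered product along the action of `w`. -/
lemma prod_filter_actDual {S : Finset (ι → ℤ)} {w : LatAut ι} (hw : w ∈ D.W)
    (hS : ∀ v ∈ D.W, ∀ γ ∈ S, v γ ∈ S) (η : ι → ℤ) {M : Type*} [CommMonoid M]
    (F G : (ι → ℤ) → M) (hFG : ∀ γ ∈ S, F (w γ) = G γ) :
    ∏ γ ∈ S.filter (fun γ => 0 < pairZ γ (actDual w η)), F γ =
      ∏ γ ∈ S.filter (fun γ => 0 < pairZ γ η), G γ := by
  refine Finset.prod_bij' (fun γ _ => w.symm γ) (fun γ _ => w γ) ?_ ?_ ?_ ?_ ?_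
  · intro γ hγ
    obtain ⟨h1, h2⟩ := Finset.mem_filter.1 hγ
    rw [pairZ_actDual] at h2
    exact Finset.mem_filter.2 ⟨hS _ (D.W.inv_mem hw) _ h1, h2⟩
  · intro γ hγ
    obtain ⟨h1, h2⟩ := Finset.mem_filter.1 hγ
    refine Finset.mem_filter.2 ⟨hS _ hw _ h1, ?_⟩
    rwa [pairZ_actDual, LinearEquiv.symm_apply_apply]
  · simp
  · simp
  · intro γ hγ
    exact (congrArg F (w.apply_symm_apply γ).symm).trans
      (hFG _ (hS _ (D.W.inv_mem hw) _ (Finset.mem_filter.1 hγ).1))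

lemma f_act (hΔ : ∀ w ∈ D.W, ∀ α ∈ D.Δ, w α ∈ D.Δ) {ρ : ι → ℂ} {k : (ι → ℤ) → ℂ}
    (hk : D.IsK ρ k) {w : LatAut ι} (hw : w ∈ D.W) (η : ι → ℤ) (z : ι → ℂ) :
    D.f k (actDual w η) (actV w z) = D.f k η z := by
  unfold f
  congr 1
  · refine prod_filter_actDual hw (fun v hv γ hγ => D.Φ_stable hv hγ) η _ _ fun γ hγ => ?_
    rw [evalC_actV, LinearEquiv.symm_apply_apply, D.k_stable hk hw hγ]
  · refine prod_filter_actDual hw hΔ η _ _ fun γ _ => ?_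
    rw [evalC_actV, LinearEquiv.symm_apply_apply]

lemma card_filter_pos {S T : Finset (ι → ℤ)} {i : ι} (hT : T = S.filter fun γ => ∀ j, 0 ≤ γ j)
    (hS : ∀ γ ∈ S, (∀ j, 0 ≤ γ j) ∨ ∀ j, γ j ≤ 0)
    (hi : ∀ γ ∈ S, γ i = -1 ∨ γ i = 0 ∨ γ i = 1) :
    ((S.filter fun γ => 0 < pairZ γ (e i)).card : ℤ) = ∑ γ ∈ T, γ i := by
  have h : S.filter (fun γ => 0 < pairZ γ (e i)) = T.filter fun γ => 0 < γ i := by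
    ext γ
    simp only [hT, Finset.mem_filter, pairZ_e_right]
    constructor
    · rintro ⟨h1, h2⟩
      refine ⟨⟨h1, (hS γ h1).resolve_right fun h => ?_⟩, h2⟩
      have := h i
      omega
    · rintro ⟨⟨h1, -⟩, h2⟩
      exact ⟨h1, h2⟩
  rw [h, Finset.card_filter, Nat.cast_sum]
  refine Finset.sum_congr rfl fun γ hγ => ?_
  rw [hT, Finset.mem_filter] at hγ
  have h1 := hi γ hγ.1
  have h2 := hγ.2 i
  split_ifs with h3 <;> push_cast <;> omega

lemma card_O (hΔ : ∀ w ∈ D.W, ∀ α ∈ D.Δ, w α ∈ D.Δ) {η : ι → ℤ} (hη : η ∈ D.Λ₁) :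
    (D.Φ.filter fun ω => 0 < pairZ ω η).card = (D.Δ.filter fun α => 0 < pairZ α η).card + 1 := by
  obtain ⟨w, hw, i, hi, rfl⟩ := (D.Λ₁_spec η).1 hη
  simp only [Finset.card_eq_sum_ones]
  have hcard : ∀ S : Finset (ι → ℤ), (∀ v ∈ D.W, ∀ γ ∈ S, v γ ∈ S) →
      ∑ γ ∈ S.filter (fun γ => 0 < pairZ γ (actDual w (e i))), 1 =
        (S.filter fun γ => 0 < pairZ γ (e i)).card := fun S hS => by
    rw [Finset.card_eq_sum_ones]
    exact prod_filter_actDual (M := Multiplicative ℕ) hw hS (e i) (fun _ => Multiplicative.ofAdd 1)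
      (fun _ => Multiplicative.ofAdd 1) fun _ _ => rfl
  rw [hcard _ fun v hv γ hγ => D.Φ_stable hv hγ, hcard _ hΔ]
  have h1 := card_filter_pos (i := i) (S := D.Φ) rfl D.C3 fun γ hγ => D.C7 i hi γ (Or.inr hγ)
  have h2 := card_filter_pos (i := i) (S := D.Δ) rfl D.C2 fun γ hγ => D.C7 i hi γ (Or.inl hγ)
  have h3 := congrFun D.C5 i
  rw [Pi.sub_apply, Finset.sum_apply, Finset.sum_apply, hi] at h3
  omega

lemma f_eq_zero_of_coord {ρ : ι → ℂ} {k : (ι → ℤ) → ℂ} (hk : D.IsK ρ k) {η : ι → ℤ} {i : ι}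
    (hη : 0 < η i) {z : ι → ℂ} (hz : z i = ρ i) : D.f k η z = 0 := by
  have hkm : k (e i) = ρ i := by simpa using D.k_apply hk D.W.one_mem i
  rw [f, Finset.prod_eq_zero (i := e i), zero_div]
  · exact Finset.mem_filter.2 ⟨D.e_mem_Φ i, by rwa [pairZ_e_left]⟩
  · rw [evalC_e, hz, hkm, sub_self]

lemma Λ₁_le_one {η : ι → ℤ} (hη : η ∈ D.Λ₁) (i : ι) : η i ≤ 1 := by
  have := pairZ_Φ_Λ₁ hη (D.e_mem_Φ i)
  rw [pairZ_e_left] at this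
  omega

lemma f_eq_zero {ρ : ι → ℂ} {k : (ι → ℤ) → ℂ} (hk : D.IsK ρ k) {η ν : ι → ℤ} (hη : η ∈ D.Λ₁)
    (hν : ν ∈ LamPlus) (hνη : ν - η ∉ LamPlus) : D.f k η (ρ + toV ν) = 0 := by
  have : ∃ i, ν i - η i < 0 := by
    by_contra! h
    exact hνη h
  obtain ⟨i, hi⟩ := this
  have h1 := hν i
  have h2 := Λ₁_le_one hη i
  refine f_eq_zero_of_coord hk (i := i) (by omega) ?_
  have h0 : ν i = 0 := by omega
  simp [toV, h0]

lemma evalC_ne_zero {ρ : ι → ℂ} (hreg : D.Regular ρ) (hdom : D.Dominant ρ) {ν : ι → ℤ}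
    (hν : ν ∈ LamPlus) {α : ι → ℤ} (hα : α ∈ D.Δ) : evalC α (ρ + toV ν) ≠ 0 := by
  have hpos : ∀ α ∈ D.Δpos, evalC α (ρ + toV ν) ≠ 0 := fun α hα => by
    rw [evalC_vadd, evalC_toV]
    have h0 : 0 ≤ pairZ α ν :=
      Finset.sum_nonneg fun i _ => mul_nonneg ((Finset.mem_filter.1 hα).2 i) (hν i)
    obtain ⟨n, hn⟩ := Int.eq_ofNat_of_zero_le h0
    rw [hn]
    cases n with
    | zero => simpa using hreg α hα
    | succ n =>
      intro h
      refine hdom α hα n ?_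
      push_cast at h
      linear_combination h
  rcases D.C2 α hα with h | h
  · exact hpos α (Finset.mem_filter.2 ⟨hα, h⟩)
  · have := hpos (-α) (Finset.mem_filter.2 ⟨D.Δ_neg α hα, fun i => by simpa using h i⟩)
    rwa [evalC_neg, neg_ne_zero] at this

end Data

namespace Data

variable {D : Data ι}

/-- The product of the positive roots. -/
def disc (D : Data ι) : MvPolynomial ι ℂ := ∏ α ∈ D.Δpos, lin α

lemma eval_disc (z : ι → ℂ) : eval z D.disc = ∏ α ∈ D.Δpos, evalC α z := by
  simp [disc, eval_lin]

lemma mem_Δ_of_mem_Δpos {α : ι → ℤ} (hα : α ∈ D.Δpos) : α ∈ D.Δ := (Finset.mem_filter.1 hα).1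

lemma disc_ne_zero : D.disc ≠ 0 :=
  Finset.prod_ne_zero_iff.2 fun _ hα => lin_ne_zero (D.ne_zero_of_mem_Δ (mem_Δ_of_mem_Δpos hα))

lemma card_le_totalDegree_disc : D.Δpos.card ≤ D.disc.totalDegree := by
  have h : ∀ S ⊆ D.Δpos, S.card ≤ (∏ α ∈ S, lin α).totalDegree := fun S => by
    induction S using Finset.induction_on with
    | empty => simp
    | insert α S hα ih =>
      intro hS
      have hΔ : ∀ β ∈ insert α S, β ≠ 0 := fun β hβ =>
        D.ne_zero_of_mem_Δ (mem_Δ_of_mem_Δpos (hS hβ))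
      rw [Finset.prod_insert hα, Finset.card_insert_of_notMem hα, totalDegree_mul_of_isDomain
        (lin_ne_zero (hΔ α (by simp)))
        (Finset.prod_ne_zero_iff.2 fun β hβ => lin_ne_zero (hΔ β (by simp [hβ])))]
      have h1 := one_le_totalDegree_lin_sub_C (hΔ α (by simp)) 0
      rw [C_0, sub_zero] at h1
      have h2 := ih ((Finset.subset_insert _ _).trans hS)
      omega
  exact h _ subset_rfl

lemma evalC_ne_zero_of_pos {z : ι → ℂ} (h : ∀ α ∈ D.Δpos, evalC α z ≠ 0) {α : ι → ℤ}
    (hα : α ∈ D.Δ) : evalC α z ≠ 0 := by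
  rcases D.C2 α hα with h' | h'
  · exact h α (Finset.mem_filter.2 ⟨hα, h'⟩)
  · have := h (-α) (Finset.mem_filter.2 ⟨D.Δ_neg α hα, fun i => by simpa using h' i⟩)
    rwa [evalC_neg, neg_ne_zero] at this

/-- Polynomials agreeing off the reflection hyperplanes are equal. -/
lemma eq_of_regular {p q : MvPolynomial ι ℂ}
    (h : ∀ z, (∀ α ∈ D.Δ, evalC α z ≠ 0) → eval z p = eval z q) : p = q := by
  refine mul_left_cancel₀ (disc_ne_zero (D := D)) (MvPolynomial.funext fun z => ?_)
  rw [map_mul, map_mul, eval_disc]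
  by_cases hz : ∏ α ∈ D.Δpos, evalC α z = 0
  · rw [hz, zero_mul, zero_mul]
  · rw [h z fun α => evalC_ne_zero_of_pos (Finset.prod_ne_zero_iff.1 hz)]

lemma exists_cofactor (η : ι → ℤ) : ∃ P : MvPolynomial ι ℂ,
    P.totalDegree + (D.Δ.filter fun α => 0 < pairZ α η).card ≤ D.Δpos.card ∧
      ∀ z, (∏ α ∈ D.Δ.filter (fun α => 0 < pairZ α η), evalC α z) * eval z P =
        eval z D.disc := by
  set A := D.Δpos.filter fun α => 0 < pairZ α η with hA
  set B := D.Δpos.filter fun α => pairZ α η < 0 with hB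
  set Z := D.Δpos.filter fun α => pairZ α η = 0 with hZ
  have hneg : ∀ {α : ι → ℤ}, α ∈ D.Δpos → ¬ ∀ i, 0 ≤ (-α) i := fun {α} hα h => by
    refine D.ne_zero_of_mem_Δ (mem_Δ_of_mem_Δpos hα) (funext fun i => ?_)
    have h1 := h i
    have h2 := (Finset.mem_filter.1 hα).2 i
    rw [Pi.neg_apply] at h1
    rw [Pi.zero_apply]
    omega
  have hR : D.Δ.filter (fun α => 0 < pairZ α η) = A ∪ B.image Neg.neg := by
    ext α
    simp only [hA, hB, Δpos, Finset.mem_filter, Finset.mem_union, Finset.mem_image]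
    constructor
    · rintro ⟨h1, h2⟩
      rcases D.C2 α h1 with h | h
      · exact Or.inl ⟨⟨h1, h⟩, h2⟩
      · exact Or.inr ⟨-α, ⟨⟨D.Δ_neg α h1, fun i => by simpa using h i⟩, by
          rw [pairZ_neg_left]; omega⟩, neg_neg α⟩
    · rintro (⟨⟨h1, -⟩, h2⟩ | ⟨β, ⟨⟨h1, -⟩, h2⟩, rfl⟩)
      · exact ⟨h1, h2⟩
      · exact ⟨D.Δ_neg β h1, by rw [pairZ_neg_left]; omega⟩
  have hAB : Disjoint A (B.image Neg.neg) := by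
    rw [Finset.disjoint_left]
    rintro α hα hα'
    obtain ⟨β, hβ, rfl⟩ := Finset.mem_image.1 hα'
    exact hneg (Finset.mem_filter.1 hβ).1 (Finset.mem_filter.1 (Finset.mem_filter.1 hα).1).2
  have hpos : D.Δpos = (A ∪ B) ∪ Z := by
    ext α
    simp only [hA, hB, hZ, Finset.mem_filter, Finset.mem_union]
    have := lt_trichotomy (pairZ α η) 0
    tauto
  have hd1 : Disjoint A B := by
    rw [Finset.disjoint_left]
    intro α h1 h2
    have h3 := (Finset.mem_filter.1 h1).2
    have h4 := (Finset.mem_filter.1 h2).2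
    omega
  have hd2 : Disjoint (A ∪ B) Z := by
    rw [Finset.disjoint_left]
    intro α h1 h2
    have h4 := (Finset.mem_filter.1 h2).2
    rcases Finset.mem_union.1 h1 with h1 | h1 <;> have h3 := (Finset.mem_filter.1 h1).2 <;> omega
  refine ⟨C ((-1) ^ B.card) * ∏ α ∈ Z, lin α, ?_, fun z => ?_⟩
  · have h1 := totalDegree_C_mul_le ((-1 : ℂ) ^ B.card) (∏ α ∈ Z, lin α)
    have h2 : (∏ α ∈ Z, lin α).totalDegree ≤ Z.card :=
      (totalDegree_finsetProd _ _).trans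
        ((Finset.sum_le_card_nsmul _ _ 1 fun α _ => totalDegree_lin_le α).trans (by simp))
    rw [hR, hpos, Finset.card_union_of_disjoint hAB, Finset.card_union_of_disjoint hd2,
      Finset.card_union_of_disjoint hd1, Finset.card_image_of_injective _ neg_injective]
    omega
  · rw [hR, Finset.prod_union hAB, Finset.prod_image fun _ _ _ _ h => neg_injective h, eval_disc,
      hpos, Finset.prod_union hd2, Finset.prod_union hd1]
    simp only [evalC_neg, Finset.prod_neg, map_mul, eval_C, map_prod, eval_lin]
    have h1 : ((-1 : ℂ) ^ B.card) * (-1) ^ B.card = 1 := by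
      rw [← mul_pow]; norm_num
    linear_combination (∏ α ∈ A, evalC α z) * (∏ α ∈ B, evalC α z) * (∏ α ∈ Z, evalC α z) * h1

lemma exists_mem_hyperplane {α β : ι → ℤ} (hα : α ∈ D.Δpos) (hβ : β ∈ D.Δpos) (h : α ≠ β) :
    ∃ z, evalC α z = 0 ∧ evalC β z ≠ 0 := by
  by_contra! hc
  have hα' := mem_Δ_of_mem_Δpos hα
  have hβ' := mem_Δ_of_mem_Δpos hβ
  obtain ⟨j, hj⟩ := Function.ne_iff.1 (D.ne_zero_of_mem_Δ hα')
  have hj0 := (Finset.mem_filter.1 hα).2 j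
  have hjβ := (Finset.mem_filter.1 hβ).2 j
  have hj1 : 0 < α j := lt_of_le_of_ne hj0 (Ne.symm hj)
  have key : α j • β = β j • α := by
    funext i
    have h1 := hc (Pi.single i (α j : ℂ) - Pi.single j (α i : ℂ))
      (by rw [evalC_vsub, evalC_single, evalC_single]; ring)
    rw [evalC_vsub, evalC_single, evalC_single, sub_eq_zero] at h1
    have h2 : β i * α j = β j * α i := by exact_mod_cast h1
    simp only [Pi.smul_apply, smul_eq_mul]
    rw [← h2, mul_comm]
  refine h (eq_of_smul_eq_smul (D.Δ_subset_roots hα') (D.Δ_subset_roots hβ')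
    (lt_of_le_of_ne hjβ fun h0 => ?_) hj1 key.symm)
  rw [← h0, zero_smul] at key
  exact D.ne_zero_of_mem_Δ hβ' ((smul_eq_zero.1 key).resolve_left hj1.ne')

/-- A polynomial `G` such that `G / disc` is invariant is divisible by `disc`. -/
lemma disc_dvd {G : MvPolynomial ι ℂ}
    (hG : ∀ w ∈ D.W, ∀ z, eval (actV w z) G * eval z D.disc =
      eval z G * eval (actV w z) D.disc) : D.disc ∣ G := by
  refine prod_lin_dvd _ (fun α hα => D.ne_zero_of_mem_Δ (mem_Δ_of_mem_Δpos hα))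
    (fun α hα β hβ h => exists_mem_hyperplane hα hβ h) G fun α hα => ?_
  have hα' := mem_Δ_of_mem_Δpos hα
  obtain ⟨w, hw, hwr⟩ := D.refl_mem α hα'
  have hs := actV_refl (D.coroot_pair α hα') hwr
  set u : MvPolynomial ι ℂ := ∏ β ∈ D.Δpos.erase α, lin β with hu
  have hdisc : D.disc = lin α * u := (Finset.mul_prod_erase _ _ hα).symm
  have hid : actP w G * u = -(G * actP w u) := by
    refine mul_left_cancel₀ (lin_ne_zero (D.ne_zero_of_mem_Δ hα')) (MvPolynomial.funext fun z => ?_)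
    have h1 := hG w hw z
    have h2 : evalC α (actV w z) = -evalC α z := by
      rw [hs, evalC_vsub, evalC_vsmul, evalC_toV, D.coroot_pair α hα']
      push_cast; ring
    rw [hdisc, map_mul, map_mul, eval_lin, eval_lin, h2] at h1
    simp only [map_mul, map_neg, eval_actP, eval_lin]
    linear_combination h1
  obtain ⟨g, -, hg2, hg3⟩ := exists_hyperplane_projection (D.ne_zero_of_mem_Δ hα')
  have hvan : ∀ z, evalC α z = 0 → eval z (G * u) = 0 := fun z hz => by
    have h1 := congrArg (eval z) hid
    have h2 : actV w z = z := by rw [hs, hz, zero_smul, sub_zero]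
    rw [map_neg, map_mul, map_mul, eval_actP, eval_actP, h2] at h1
    rw [map_mul]
    linear_combination h1 / 2
  have h0 : bind₁ g (G * u) = 0 := MvPolynomial.funext fun z => by
    rw [eval_bind₁', hvan _ (hg2 z), map_zero]
  rw [map_mul, mul_eq_zero] at h0
  have hu0 : bind₁ g u ≠ 0 := by
    rw [hu, map_prod, Finset.prod_ne_zero_iff]
    intro β hβ h2
    obtain ⟨hne, hβ'⟩ := Finset.mem_erase.1 hβ
    obtain ⟨z, hz1, hz2⟩ := exists_mem_hyperplane hα hβ' hne.symm
    have h3 := congrArg (eval z) h2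
    rw [eval_bind₁', hg3 z hz1, eval_lin, map_zero] at h3
    exact hz2 h3
  intro z hz
  have h4 := congrArg (eval z) (h0.resolve_right hu0)
  rwa [eval_bind₁', hg3 z hz, map_zero] at h4

lemma evalC_actV_ne_zero (hΔ : ∀ w ∈ D.W, ∀ α ∈ D.Δ, w α ∈ D.Δ) {w : LatAut ι} (hw : w ∈ D.W)
    {z : ι → ℂ} (hz : ∀ α ∈ D.Δ, evalC α z ≠ 0) : ∀ α ∈ D.Δ, evalC α (actV w z) ≠ 0 :=
  fun α hα => by
    rw [evalC_actV]
    exact hz _ (hΔ _ (D.W.inv_mem hw) _ hα)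

/-- Sums `∑ f_η g_η` over `Λ₁` with `g` equivariant are invariant polynomials. -/
lemma exists_poly_sum_f (hΔ : ∀ w ∈ D.W, ∀ α ∈ D.Δ, w α ∈ D.Δ) {ρ : ι → ℂ}
    {k : (ι → ℤ) → ℂ} (hk : D.IsK ρ k) (g : (ι → ℤ) → MvPolynomial ι ℂ)
    (hg : ∀ w ∈ D.W, ∀ η z, eval (actV w z) (g (actDual w η)) = eval z (g η)) (m : ℕ)
    (hgm : ∀ η ∈ D.Λ₁, g η ≠ 0 → (g η).totalDegree + 1 ≤ m) :
    ∃ q, D.WInv q ∧ q.totalDegree ≤ m ∧ ∀ z, (∀ α ∈ D.Δ, evalC α z ≠ 0) →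
      eval z q = ∑ η ∈ D.Λ₁, D.f k η z * eval z (g η) := by
  choose P hPdeg hP using exists_cofactor (D := D)
  have hinv : ∀ w ∈ D.W, ∀ z, ∑ η ∈ D.Λ₁, D.f k η (actV w z) * eval (actV w z) (g η) =
      ∑ η ∈ D.Λ₁, D.f k η z * eval z (g η) := fun w hw z => by
    refine (Finset.sum_bij' (fun η _ => actDual w η) (fun η _ => actDual w⁻¹ η)
      (fun η hη => D.Λ₁_stable hw hη) (fun η hη => D.Λ₁_stable (D.W.inv_mem hw) hη)
      (fun η _ => actDual_inv_actDual w η) (fun η _ => actDual_actDual_inv w η) fun η _ => ?_).symm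
    rw [f_act hΔ hk hw, hg w hw]
  set G : MvPolynomial ι ℂ := ∑ η ∈ D.Λ₁,
    (∏ ω ∈ D.Φ.filter (fun ω => 0 < pairZ ω η), (lin ω - C (k ω))) * P η * g η with hG
  have hGz : ∀ z, (∀ α ∈ D.Δ, evalC α z ≠ 0) →
      eval z G = eval z D.disc * ∑ η ∈ D.Λ₁, D.f k η z * eval z (g η) := fun z hz => by
    rw [hG, map_sum, Finset.mul_sum]
    refine Finset.sum_congr rfl fun η _ => ?_
    have h0 : ∏ α ∈ D.Δ.filter (fun α => 0 < pairZ α η), evalC α z ≠ 0 :=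
      Finset.prod_ne_zero_iff.2 fun α hα => hz α (Finset.mem_filter.1 hα).1
    rw [← hP η z, f]
    simp only [map_mul, map_prod, map_sub, eval_lin, eval_C]
    field_simp
  have hdG : D.disc ∣ G := by
    refine disc_dvd fun w hw => ?_
    have h1 : actP w G * D.disc = G * actP w D.disc := eq_of_regular fun z hz => by
      rw [map_mul, map_mul, eval_actP, eval_actP, hGz z hz,
        hGz _ (evalC_actV_ne_zero hΔ hw hz), hinv w hw]
      ring
    intro z
    simpa [eval_actP] using congrArg (eval z) h1
  obtain ⟨q, hq⟩ := hdG
  have hqz : ∀ z, (∀ α ∈ D.Δ, evalC α z ≠ 0) →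
      eval z q = ∑ η ∈ D.Λ₁, D.f k η z * eval z (g η) := fun z hz => by
    have h1 := hGz z hz
    rw [hq, map_mul] at h1
    refine mul_left_cancel₀ ?_ h1
    rw [eval_disc]
    exact Finset.prod_ne_zero_iff.2 fun α hα => hz α (mem_Δ_of_mem_Δpos hα)
  refine ⟨q, fun w hw z => ?_, ?_, hqz⟩
  · have h1 : actP w q = q := eq_of_regular fun z hz => by
      rw [eval_actP, hqz z hz, hqz _ (evalC_actV_ne_zero hΔ hw hz), hinv w hw]
    rw [← eval_actP, h1]
  · by_cases hq0 : q = 0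
    · rw [hq0]; simp
    have h1 : G.totalDegree ≤ D.Δpos.card + m := by
      refine totalDegree_finsetSum_le fun η hη => ?_
      by_cases h0 : g η = 0
      · rw [h0, mul_zero]; simp
      have h2 := hgm η hη h0
      have h3 := hPdeg η
      have h4 := card_O hΔ hη
      have h5 : (∏ ω ∈ D.Φ.filter (fun ω => 0 < pairZ ω η), (lin ω - C (k ω))).totalDegree ≤
          (D.Φ.filter fun ω => 0 < pairZ ω η).card :=
        (totalDegree_finsetProd _ _).trans ((Finset.sum_le_card_nsmul _ _ 1
          fun ω _ => totalDegree_lin_sub_C_le ω _).trans (by simp))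
      refine (totalDegree_mul _ _).trans ?_
      have h6 := totalDegree_mul (∏ ω ∈ D.Φ.filter (fun ω => 0 < pairZ ω η), (lin ω - C (k ω))) (P η)
      omega
    rw [hq, totalDegree_mul_of_isDomain disc_ne_zero hq0] at h1
    have := card_le_totalDegree_disc (D := D)
    omega

end Data

lemma exists_affine {p : MvPolynomial ι ℂ} (hp : p.totalDegree ≤ 1) :
    ∃ (a : ℂ) (c : ι → ℂ), ∀ z, eval z p = a + ∑ i, c i * z i := by
  have hmon : ∀ m : ι →₀ ℕ, ∃ (a : ℂ) (c : ι → ℂ), m ∈ p.support →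
      ∀ z, eval z (monomial m (p.coeff m)) = a + ∑ i, c i * z i := fun m => by
    by_cases h0 : m = 0
    · exact ⟨p.coeff m, 0, fun _ z => by simp [h0]⟩
    obtain ⟨i, hi⟩ := Finsupp.ne_iff.1 h0
    refine ⟨0, Pi.single i (p.coeff m), fun hm z => ?_⟩
    have h1 := (le_totalDegree hm).trans hp
    rw [Finsupp.sum_fintype _ _ fun _ => rfl, ← Finset.add_sum_erase _ _ (Finset.mem_univ i)] at h1
    rw [Finsupp.zero_apply] at hi
    have h2 : ∑ j ∈ Finset.univ.erase i, m j = 0 := by omega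
    have h3 : m = Finsupp.single i 1 := by
      ext j
      by_cases hj : j = i
      · rw [hj, Finsupp.single_eq_same]; omega
      · rw [Finsupp.single_eq_of_ne hj]
        exact Finset.sum_eq_zero_iff.1 h2 j (Finset.mem_erase.2 ⟨hj, Finset.mem_univ j⟩)
    rw [eval_monomial, Finsupp.prod_fintype _ _ fun _ => pow_zero _, zero_add]
    rw [Finset.sum_eq_single i (fun j _ hj => by rw [Pi.single_eq_of_ne hj, zero_mul])
      (fun h => absurd (Finset.mem_univ i) h), Pi.single_eq_same]
    rw [Finset.prod_eq_single i (fun j _ hj => by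
      rw [h3, Finsupp.single_eq_of_ne hj, pow_zero]) (fun h => absurd (Finset.mem_univ i) h)]
    congr 1
    rw [h3, Finsupp.single_eq_same, pow_one]
  choose a c hac using hmon
  refine ⟨∑ m ∈ p.support, a m, fun i => ∑ m ∈ p.support, c m i, fun z => ?_⟩
  conv_lhs => rw [p.as_sum, map_sum]
  rw [Finset.sum_congr rfl fun m hm => hac m hm z, Finset.sum_add_distrib]
  simp only [Finset.sum_mul]
  rw [Finset.sum_comm]

namespace Data

variable {D : Data ι}

lemma exists_coord_pos {η : ι → ℤ} (hη : η ∈ D.Λ₁) {i : ι} (hi : D.ell i = 1) (hne : η ≠ e i) :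
    ∃ j, j ≠ i ∧ 0 < η j := by
  by_contra! hc
  have h1 := D.ell_Λ₁ hη
  rw [pairZ, ← Finset.add_sum_erase _ _ (Finset.mem_univ i), hi, one_mul] at h1
  have h2 := Λ₁_le_one hη i
  have h3 : ∀ j ∈ Finset.univ.erase i, D.ell j * η j ≤ 0 := fun j hj =>
    mul_nonpos_of_nonneg_of_nonpos (D.C6 j).le (hc j (Finset.ne_of_mem_erase hj))
  have h4 := Finset.sum_nonpos h3
  have h5 := (Finset.sum_eq_zero_iff_of_nonpos h3).1 (by omega)
  refine hne (funext fun j => ?_)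
  rw [e_apply]
  split_ifs with hj
  · subst hj; omega
  · exact (mul_eq_zero.1 (h5 j (by simp [hj]))).resolve_left (D.C6 j).ne'

/-- The value of `L 1`. -/
lemma sum_f_eq (hΔ : ∀ w ∈ D.W, ∀ α ∈ D.Δ, w α ∈ D.Δ) {ρ : ι → ℂ} (hreg : D.Regular ρ)
    (hdom : D.Dominant ρ) {k : (ι → ℤ) → ℂ} (hk : D.IsK ρ k) {ν : ι → ℤ} (hν : ν ∈ LamPlus) :
    ∑ η ∈ D.Λ₁, D.f k η (ρ + toV ν) = pairZ D.ell ν := by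
  obtain ⟨q, hqW, hq1, hq⟩ := exists_poly_sum_f hΔ hk (fun _ => 1) (fun _ _ _ _ => by simp) 1
    (fun _ _ _ => by simp)
  obtain ⟨a, c, hac⟩ := exists_affine hq1
  have hqν : ∀ ν ∈ LamPlus, a + ∑ i, c i * (ρ + toV ν) i = ∑ η ∈ D.Λ₁, D.f k η (ρ + toV ν) :=
    fun ν hν => by
      rw [← hac, hq _ fun α => evalC_ne_zero hreg hdom hν]
      simp
  have h0 : a + ∑ i, c i * ρ i = 0 := by
    have h1 := hqν 0 fun _ => le_rfl
    rw [toV_zero, add_zero] at h1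
    rw [h1]
    refine Finset.sum_eq_zero fun η hη => ?_
    have h2 := f_eq_zero hk hη (ν := 0) (fun _ => le_rfl) fun h => by
      have h3 : pairZ D.ell η ≤ 0 := Finset.sum_nonpos fun i _ =>
        mul_nonpos_of_nonneg_of_nonpos (D.C6 i).le (by have := h i; simp at this; exact this)
      have := D.ell_Λ₁ hη
      omega
    rwa [toV_zero, add_zero] at h2
  have hlin : ∀ ν ∈ LamPlus, ∑ i, c i * toV ν i = ∑ η ∈ D.Λ₁, D.f k η (ρ + toV ν) :=
    fun ν hν => by
      rw [← hqν ν hν]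
      simp only [Pi.add_apply, mul_add, Finset.sum_add_distrib]
      linear_combination -h0
  have hc : c = fun i => (D.ell i : ℂ) := by
    refine D.C8 _ _ (fun w hw z => ?_) (fun w hw z => D.ell_actV hw z) fun i hi => ?_
    · have h1 := hqW w hw z
      rw [hac, hac] at h1
      exact add_left_cancel h1
    · have hmem : e i ∈ D.Λ₁ := (D.Λ₁_spec _).2 ⟨1, D.W.one_mem, i, hi, (actDual_one _).symm⟩
      have hval : ∀ γ, γ ∈ D.Δ ∨ γ ∈ D.Φ → 0 < pairZ γ (e i) → γ i = 1 := fun γ hγ h => by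
        rw [pairZ_e_right] at h
        have := D.C7 i hi γ hγ
        omega
      have key : Polynomial.C (c i) * Polynomial.X *
          (∏ α ∈ D.Δ.filter (fun α => 0 < pairZ α (e i)),
            (Polynomial.X + Polynomial.C (evalC α ρ))) =
          ∏ ω ∈ D.Φ.filter (fun ω => 0 < pairZ ω (e i)),
            (Polynomial.X + Polynomial.C (evalC ω ρ - k ω)) := by
        refine Polynomial.eq_of_infinite_eval_eq _ _
          (Set.infinite_of_injective_forall_mem (f := fun n : ℕ => (n : ℂ)) Nat.cast_injective
            fun n => ?_)
        have hpos : (n : ℤ) • e i ∈ LamPlus := fun j => by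
          rw [Pi.smul_apply, e_apply]
          split_ifs <;> simp
        have h1 := hlin _ hpos
        rw [Finset.sum_eq_single_of_mem (e i) hmem fun η hη hne => by
            obtain ⟨j, hji, hj⟩ := exists_coord_pos hη hi hne
            refine f_eq_zero_of_coord hk hj ?_
            simp [toV, e_apply, hji],
          Finset.sum_eq_single_of_mem i (Finset.mem_univ i) fun j _ hj => by
            simp [toV, e_apply, hj], f, eq_div_iff (Finset.prod_ne_zero_iff.2 fun α hα =>
              evalC_ne_zero hreg hdom hpos (Finset.mem_filter.1 hα).1)] at h1
        have hev : ∀ γ, γ ∈ D.Δ ∨ γ ∈ D.Φ → 0 < pairZ γ (e i) →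
            evalC γ (ρ + toV ((n : ℤ) • e i)) = n + evalC γ ρ := fun γ hγ h => by
          rw [evalC_vadd, toV_smul, evalC_vsmul, evalC_toV, pairZ_e_right, hval γ hγ h]
          push_cast; ring
        rw [Finset.prod_congr rfl fun α hα => hev α (Or.inl (Finset.mem_filter.1 hα).1)
            (Finset.mem_filter.1 hα).2] at h1
        simp only [Set.mem_ofPred_eq, Polynomial.eval_mul, Polynomial.eval_C, Polynomial.eval_X,
          Polynomial.eval_prod, Polynomial.eval_add]
        simp only [toV, Pi.smul_apply, e_apply, if_true, smul_eq_mul, mul_one,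
          Int.cast_natCast] at h1
        rw [h1]
        exact Finset.prod_congr rfl fun ω hω => by
          rw [hev ω (Or.inr (Finset.mem_filter.1 hω).1) (Finset.mem_filter.1 hω).2]
          ring
      have h2 := congrArg Polynomial.leadingCoeff key
      have hmonic : ∀ (S : Finset (ι → ℤ)) (b : (ι → ℤ) → ℂ),
          (∏ γ ∈ S, (Polynomial.X + Polynomial.C (b γ))).leadingCoeff = 1 := fun S b =>
        Polynomial.monic_prod_of_monic _ _ fun γ _ => Polynomial.monic_X_add_C _
      rw [Polynomial.leadingCoeff_mul, Polynomial.leadingCoeff_mul, hmonic, hmonic,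
        Polynomial.leadingCoeff_C, Polynomial.leadingCoeff_X, mul_one, mul_one] at h2
      rw [h2, hi, Int.cast_one]
  rw [← hlin ν hν, hc, pairZ]
  simp [toV]

lemma evalMap_injective (hC0 : D.C0) {ρ : ι → ℂ}
    {pl : (ι → ℤ) → MvPolynomial ι ℂ} (hpl : ∀ lam ∈ LamPlus, D.CapelliAt ρ lam (pl lam))
    (N : ℕ) : Function.Injective (D.evalMap ρ N) := by
  obtain ⟨ρ', -, -, -, h⟩ := hC0
  exact D.evalMap_injective_of_surjective (D.evalMap_injective_of_unique N h)
    (D.evalMap_surjective_of_capelli fun lam hlam => ⟨_, hpl lam hlam⟩)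

/-- The recurrence satisfied by the values of the Capelli polynomials. -/
lemma capelli_recurrence (hC0 : D.C0) {ρ : ι → ℂ} (hreg : D.Regular ρ)
    (hdom : D.Dominant ρ) {k : (ι → ℤ) → ℂ} (hk : D.IsK ρ k)
    {pl : (ι → ℤ) → MvPolynomial ι ℂ} (hpl : ∀ lam ∈ LamPlus, D.CapelliAt ρ lam (pl lam))
    {lam ν : ι → ℤ} (hlam : lam ∈ LamPlus) (hν : ν ∈ LamPlus) :
    ((pairZ D.ell ν : ℂ) - pairZ D.ell lam) * eval (ρ + toV ν) (pl lam) =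
      ∑ η ∈ D.Λ₁, D.f k η (ρ + toV ν) * eval (ρ + toV (ν - η)) (pl lam) := by
  have hΔ : ∀ w ∈ D.W, ∀ α ∈ D.Δ, w α ∈ D.Δ := fun w hw α hα => Δ_stable hC0 hw hα
  obtain ⟨hW, hdeg, hval⟩ := hpl lam hlam
  set p := pl lam
  obtain ⟨m, hm⟩ := Int.eq_ofNat_of_zero_le (D.pairZ_ell_nonneg hlam)
  rw [hm] at hdeg hval ⊢
  obtain ⟨q, hqW, hq1, hq⟩ := exists_poly_sum_f hΔ hk (fun η => shiftP η p - p)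
    (fun w hw η z => by
      rw [map_sub, map_sub, eval_shiftP, eval_shiftP, ← actV_toV, ← actV_sub, hW w hw, hW w hw])
    m (fun η _ h => (totalDegree_shiftP_sub_lt η p h).trans (by exact_mod_cast hdeg))
  have hqν : ∀ ν ∈ LamPlus, eval (ρ + toV ν) q =
      ∑ η ∈ D.Λ₁, D.f k η (ρ + toV ν) * eval (ρ + toV (ν - η)) p -
        pairZ D.ell ν * eval (ρ + toV ν) p := fun ν hν => by
    rw [hq _ fun α => evalC_ne_zero hreg hdom hν, ← sum_f_eq hΔ hreg hdom hk hν, Finset.sum_mul,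
      ← Finset.sum_sub_distrib]
    refine Finset.sum_congr rfl fun η _ => ?_
    rw [map_sub, eval_shiftP, toV_sub, add_sub_assoc]
    ring
  have hzero : q + C (m : ℂ) * p = 0 := by
    refine D.eq_zero_of_injective (evalMap_injective hC0 hpl m) (WInv.add D hqW (WInv.C_mul D _ hW))
      ((totalDegree_add _ _).trans (max_le hq1 ((totalDegree_C_mul_le _ _).trans
        (by exact_mod_cast hdeg)))) fun ν hν hνm => ?_
    have h0 : ∑ η ∈ D.Λ₁, D.f k η (ρ + toV ν) * eval (ρ + toV (ν - η)) p = 0 := by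
      refine Finset.sum_eq_zero fun η hη => ?_
      by_cases hνη : ν - η ∈ LamPlus
      · have h1 : pairZ D.ell (ν - η) = pairZ D.ell ν - 1 := by rw [pairZ_sub_right, D.ell_Λ₁ hη]
        rw [hval _ hνη (by omega), if_neg, mul_zero]
        rintro rfl
        omega
      · rw [f_eq_zero hk hη hν hνη, zero_mul]
    rw [map_add, map_mul, eval_C, hqν ν hν, h0, hval ν hν hνm]
    split_ifs with h
    · rw [h, hm]; push_cast; ring
    · ring
  have h1 := congrArg (eval (ρ + toV ν)) hzero
  rw [map_add, map_mul, eval_C, hqν ν hν, map_zero] at h1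
  push_cast
  linear_combination -h1

end Data

section Paths

variable {D : Data ι}

lemma pathPt_snoc {n : ℕ} (lam : ι → ℤ) (s : Fin n → ι → ℤ) (η : ι → ℤ) {m : ℕ} (hm : m ≤ n) :
    pathPt lam (Fin.snoc (α := fun _ => ι → ℤ) s η : Fin (n + 1) → ι → ℤ) m = pathPt lam s m := by
  unfold pathPt
  rw [Finset.sum_filter, Finset.sum_filter, Fin.sum_univ_castSucc]
  simp [Fin.snoc_castSucc, Nat.not_lt.2 hm]

lemma pathPt_snoc_last {n : ℕ} (lam : ι → ℤ) (s : Fin n → ι → ℤ) (η : ι → ℤ) :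
    pathPt lam (Fin.snoc (α := fun _ => ι → ℤ) s η : Fin (n + 1) → ι → ℤ) (n + 1) =
      pathPt lam s n + η := by
  unfold pathPt
  rw [Finset.sum_filter, Finset.sum_filter, Fin.sum_univ_castSucc, add_assoc]
  congr 2
  · refine Finset.sum_congr rfl fun i _ => ?_
    rw [Fin.snoc_castSucc, if_pos (by simp), if_pos i.2]
  · simp

lemma mem_posPaths {lam ν : ι → ℤ} {n : ℕ} {s : Fin n → ι → ℤ} :
    s ∈ posPaths D lam ν n ↔ (∀ i, s i ∈ D.Λ₁) ∧ (∀ m ≤ n, pathPt lam s m ∈ LamPlus) ∧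
      pathPt lam s n = ν := by
  simp [posPaths, Fintype.mem_piFinset]

lemma snoc_mem_posPaths {lam ν η : ι → ℤ} (hν : ν ∈ LamPlus) {n : ℕ} {s : Fin n → ι → ℤ} :
    (Fin.snoc (α := fun _ => ι → ℤ) s η : Fin (n + 1) → ι → ℤ) ∈ posPaths D lam ν (n + 1) ↔
      (η ∈ D.Λ₁ ∧ ν - η ∈ LamPlus) ∧ s ∈ posPaths D lam (ν - η) n := by
  rw [mem_posPaths, mem_posPaths, pathPt_snoc_last]
  constructor
  · rintro ⟨h1, h2, h3⟩
    have h4 : pathPt lam s n = ν - η := eq_sub_of_add_eq h3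
    have h5 : ∀ m ≤ n, pathPt lam s m ∈ LamPlus := fun m hm => by
      simpa only [pathPt_snoc lam s η hm] using h2 m (Nat.le_succ_of_le hm)
    refine ⟨⟨by simpa using h1 (Fin.last n), h4 ▸ h5 n le_rfl⟩, fun i => ?_, h5, h4⟩
    simpa using h1 i.castSucc
  · rintro ⟨⟨h1, -⟩, h2, h3, h4⟩
    have h5 : pathPt lam s n + η = ν := by rw [h4, sub_add_cancel]
    refine ⟨fun i => ?_, fun m hm => ?_, h5⟩
    · refine Fin.lastCases ?_ (fun j => ?_) i
      · simpa using h1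
      · simpa using h2 j
    · rcases Nat.le_succ_iff.1 hm with h | h
      · rw [pathPt_snoc lam s η h]; exact h3 m h
      · rw [h, pathPt_snoc_last, h5]; exact hν

lemma sum_posPaths_succ {lam ν : ι → ℤ} (hν : ν ∈ LamPlus) {n : ℕ}
    (G : (Fin (n + 1) → ι → ℤ) → ℂ) :
    ∑ s ∈ posPaths D lam ν (n + 1), G s =
      ∑ η ∈ D.Λ₁.filter (fun η => ν - η ∈ LamPlus), ∑ s ∈ posPaths D lam (ν - η) n,
        G (Fin.snoc (α := fun _ => ι → ℤ) s η) := by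
  rw [Finset.sum_sigma']
  refine Finset.sum_bij' (fun s _ => ⟨s (Fin.last n), Fin.init (α := fun _ => ι → ℤ) s⟩)
    (fun x _ => Fin.snoc (α := fun _ => ι → ℤ) x.2 x.1) (fun s hs => ?_) (fun x hx => ?_)
    (fun s _ => Fin.snoc_init_self s) (fun x _ => by simp) fun s _ => ?_
  · rw [← Fin.snoc_init_self (α := fun _ => ι → ℤ) s, snoc_mem_posPaths hν] at hs
    exact Finset.mem_sigma.2 ⟨Finset.mem_filter.2 hs.1, hs.2⟩
  · obtain ⟨h1, h2⟩ := Finset.mem_sigma.1 hx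
    exact (snoc_mem_posPaths hν).2 ⟨Finset.mem_filter.1 h1, h2⟩
  · rw [Fin.snoc_init_self (α := fun _ => ι → ℤ) s]

/-- The weight of a path with respect to `F`. -/
def pathWeight (F : (ι → ℤ) → (ι → ℤ) → ℂ) (lam : ι → ℤ) {n : ℕ} (s : Fin n → ι → ℤ) : ℂ :=
  ∏ i : Fin n, F (s i) (pathPt lam s ((i : ℕ) + 1))

lemma pathWeight_snoc (F : (ι → ℤ) → (ι → ℤ) → ℂ) (lam : ι → ℤ) {n : ℕ} (s : Fin n → ι → ℤ)
    (η : ι → ℤ) : pathWeight F lam (Fin.snoc (α := fun _ => ι → ℤ) s η : Fin (n + 1) → ι → ℤ) =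
      pathWeight F lam s * F η (pathPt lam s n + η) := by
  unfold pathWeight
  rw [Fin.prod_univ_castSucc]
  congr 1
  · refine Finset.prod_congr rfl fun i _ => ?_
    rw [Fin.snoc_castSucc, Fin.val_castSucc, pathPt_snoc lam s η i.2]
  · rw [Fin.snoc_last, Fin.val_last, pathPt_snoc_last]

lemma posPaths_zero {lam ν : ι → ℤ} (hν : ν ∈ LamPlus) :
    posPaths D lam ν 0 = if lam = ν then Finset.univ else ∅ := by
  ext s
  rw [mem_posPaths]
  have h0 : ∀ m, pathPt lam s m = lam := fun m => by simp [pathPt]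
  simp only [h0]
  split_ifs with h
  · subst h
    simp [hν, eq_iff_true_of_subsingleton]
  · simp [h]

lemma sum_pathWeight_zero (F : (ι → ℤ) → (ι → ℤ) → ℂ) {lam ν : ι → ℤ} (hν : ν ∈ LamPlus) :
    ∑ s ∈ posPaths D lam ν 0, pathWeight F lam s = if lam = ν then 1 else 0 := by
  rw [posPaths_zero hν]
  split_ifs <;> simp [pathWeight]

lemma sum_pathWeight_succ (F : (ι → ℤ) → (ι → ℤ) → ℂ) {lam ν : ι → ℤ} (hν : ν ∈ LamPlus) (n : ℕ) :
    ∑ s ∈ posPaths D lam ν (n + 1), pathWeight F lam s =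
      ∑ η ∈ D.Λ₁.filter (fun η => ν - η ∈ LamPlus),
        (∑ s ∈ posPaths D lam (ν - η) n, pathWeight F lam s) * F η ν := by
  rw [sum_posPaths_succ hν]
  refine Finset.sum_congr rfl fun η _ => ?_
  rw [Finset.sum_mul]
  refine Finset.sum_congr rfl fun s hs => ?_
  rw [pathWeight_snoc, (mem_posPaths.1 hs).2.2, sub_add_cancel]

lemma sub_mem_pts {N : ℕ} {ν η : ι → ℤ} (hν : ν ∈ D.pts N)
    (hη : η ∈ D.Λ₁.filter fun η => ν - η ∈ LamPlus) : ν - η ∈ D.pts N := by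
  obtain ⟨h1, h2⟩ := Finset.mem_filter.1 hη
  have h3 := (D.mem_pts.1 hν).2
  refine D.mem_pts.2 ⟨h2, ?_⟩
  rw [pairZ_sub_right, D.ell_Λ₁ h1]
  omega

/-- Splitting positive paths at their `i`-th point. -/
lemma sum_pathWeight_split (F : (ι → ℤ) → (ι → ℤ) → ℂ) (H : (ι → ℤ) → ℂ) (N : ℕ)
    (lam : ι → ℤ) (i j : ℕ) {ν : ι → ℤ} (hν : ν ∈ D.pts N) :
    ∑ s ∈ posPaths D lam ν (i + j), H (pathPt lam s i) * pathWeight F lam s =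
      ∑ κ ∈ D.pts N, H κ * (∑ s ∈ posPaths D lam κ i, pathWeight F lam s) *
        ∑ s ∈ posPaths D κ ν j, pathWeight F κ s := by
  induction j generalizing ν with
  | zero =>
    simp only [sum_pathWeight_zero F (D.mem_pts.1 hν).1]
    rw [Finset.sum_eq_single_of_mem ν hν fun κ _ hκ => by rw [if_neg hκ, mul_zero], if_pos rfl,
      mul_one, Finset.mul_sum]
    exact Finset.sum_congr rfl fun s hs => by rw [← (mem_posPaths.1 hs).2.2]
  | succ j ih =>
    have hν' := (D.mem_pts.1 hν).1
    rw [Finset.sum_congr rfl fun κ _ => (congrArg _ (sum_pathWeight_succ F hν' j)).trans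
      (Finset.mul_sum _ _ _), ← add_assoc, sum_posPaths_succ hν', Finset.sum_comm]
    refine Finset.sum_congr rfl fun η hη => ?_
    rw [Finset.sum_congr rfl fun κ _ => (mul_assoc _ _ _).symm, ← Finset.sum_mul,
      ← ih (sub_mem_pts hν hη), Finset.sum_mul]
    refine Finset.sum_congr rfl fun s hs => ?_
    rw [pathWeight_snoc, (mem_posPaths.1 hs).2.2, sub_add_cancel,
      pathPt_snoc lam s η (Nat.le_add_right i j), mul_assoc]

lemma pairZ_sum_right {κ : Type*} (s : Finset κ) (a : ι → ℤ) (η : κ → ι → ℤ) :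
    pairZ a (∑ j ∈ s, η j) = ∑ j ∈ s, pairZ a (η j) := by
  simp only [pairZ, Finset.sum_apply, Finset.mul_sum]
  exact Finset.sum_comm

lemma posPaths_eq_empty {lam ν : ι → ℤ} {n : ℕ} (h : pairZ D.ell ν ≠ pairZ D.ell lam + n) :
    posPaths D lam ν n = ∅ := by
  refine Finset.eq_empty_of_forall_notMem fun s hs => h ?_
  obtain ⟨h1, -, h2⟩ := mem_posPaths.1 hs
  rw [← h2, pathPt, pairZ_add_right, Finset.filter_true_of_mem fun i _ => i.2, pairZ_sum_right]
  congr 1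
  rw [Finset.sum_congr rfl fun i _ => D.ell_Λ₁ (h1 i)]
  simp

end Paths

section Inversion

variable {D : Data ι} {F v : (ι → ℤ) → (ι → ℤ) → ℂ}

/-- Solving a triangular recurrence by path sums. -/
lemma sum_pathWeight_eq (hF : ∀ ν ∈ LamPlus, ∀ η ∈ D.Λ₁, ν - η ∉ LamPlus → F η ν = 0)
    (hv0 : ∀ κ ∈ LamPlus, ∀ ν ∈ LamPlus, pairZ D.ell ν ≤ pairZ D.ell κ →
      v κ ν = if ν = κ then 1 else 0)
    (hvr : ∀ κ ∈ LamPlus, ∀ ν ∈ LamPlus, ((pairZ D.ell ν : ℂ) - pairZ D.ell κ) * v κ ν =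
      ∑ η ∈ D.Λ₁, F η ν * v κ (ν - η))
    {κ : ι → ℤ} (hκ : κ ∈ LamPlus) {n : ℕ} {ν : ι → ℤ} (hν : ν ∈ LamPlus)
    (hn : pairZ D.ell ν = pairZ D.ell κ + n) :
    ∑ s ∈ posPaths D κ ν n, pathWeight F κ s = n.factorial * v κ ν := by
  induction n generalizing ν with
  | zero =>
    rw [sum_pathWeight_zero F hν, hv0 κ hκ ν hν (by simpa using hn.le)]
    simp [eq_comm]
  | succ n ih =>
    have h1 := hvr κ hκ ν hν
    rw [hn] at h1
    rw [sum_pathWeight_succ F hν, Nat.factorial_succ]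
    have h2 : ∑ η ∈ D.Λ₁, F η ν * v κ (ν - η) =
        ∑ η ∈ D.Λ₁.filter (fun η => ν - η ∈ LamPlus), F η ν * v κ (ν - η) := by
      refine (Finset.sum_filter_of_ne fun η hη hne => ?_).symm
      by_contra h
      exact hne (by rw [hF ν hν η hη h, zero_mul])
    rw [h2] at h1
    rw [Finset.sum_congr rfl fun η hη => by
      obtain ⟨h3, h4⟩ := Finset.mem_filter.1 hη
      rw [ih h4 (by rw [pairZ_sub_right, D.ell_Λ₁ h3, hn]; push_cast; ring)]]
    push_cast at h1 ⊢
    have h5 : ∀ η, (n.factorial : ℂ) * v κ (ν - η) * F η ν =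
        n.factorial * (F η ν * v κ (ν - η)) := fun η => by ring
    simp only [h5, ← Finset.mul_sum]
    rw [← h1]
    ring

/-- Alternating path sums in terms of the solution of the recurrence. -/
lemma sum_alternating (hF : ∀ ν ∈ LamPlus, ∀ η ∈ D.Λ₁, ν - η ∉ LamPlus → F η ν = 0)
    (hv0 : ∀ κ ∈ LamPlus, ∀ ν ∈ LamPlus, pairZ D.ell ν ≤ pairZ D.ell κ →
      v κ ν = if ν = κ then 1 else 0)
    (hvr : ∀ κ ∈ LamPlus, ∀ ν ∈ LamPlus, ((pairZ D.ell ν : ℂ) - pairZ D.ell κ) * v κ ν =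
      ∑ η ∈ D.Λ₁, F η ν * v κ (ν - η))
    {σ ν : ι → ℤ} (hσ : σ ∈ LamPlus) (hν : ν ∈ LamPlus) {n N : ℕ}
    (hn : pairZ D.ell ν = pairZ D.ell σ + n) (hN : pairZ D.ell ν = N) (H : (ι → ℤ) → ℂ) :
    ∑ s ∈ posPaths D σ ν n, (∑ i ∈ Finset.range (n + 1),
        ((-1 : ℂ) ^ (n - i) / ((Nat.factorial i : ℂ) * (Nat.factorial (n - i) : ℂ))) *
          H (pathPt σ s i)) * pathWeight F σ s =
      ∑ κ ∈ D.pts N, (-1 : ℂ) ^ (pairZ D.ell ν - pairZ D.ell κ).toNat * (H κ * v σ κ) * v κ ν := by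
  have hνN : ν ∈ D.pts N := D.mem_pts.2 ⟨hν, hN.le⟩
  simp only [Finset.sum_mul]
  rw [Finset.sum_comm]
  have hsplit : ∀ i ∈ Finset.range (n + 1),
      ∑ s ∈ posPaths D σ ν n,
        ((-1 : ℂ) ^ (n - i) / ((Nat.factorial i : ℂ) * (Nat.factorial (n - i) : ℂ))) *
          H (pathPt σ s i) * pathWeight F σ s =
      ∑ κ ∈ D.pts N, if pairZ D.ell κ = pairZ D.ell σ + i then
        (-1 : ℂ) ^ (n - i) * (H κ * v σ κ) * v κ ν else 0 := fun i hi => by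
    have hin : i ≤ n := Nat.lt_succ_iff.1 (Finset.mem_range.1 hi)
    simp only [mul_assoc, ← Finset.mul_sum]
    have h1 := sum_pathWeight_split F H N σ i (n - i) hνN
    rw [Nat.add_sub_cancel' hin] at h1
    rw [h1, Finset.mul_sum]
    refine Finset.sum_congr rfl fun κ hκ => ?_
    have hκ' := (D.mem_pts.1 hκ).1
    split_ifs with h2
    · rw [sum_pathWeight_eq hF hv0 hvr hσ hκ' h2, sum_pathWeight_eq hF hv0 hvr hκ' hν
        (by rw [hn, h2]; push_cast [Nat.cast_sub hin]; ring)]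
      have h3 := Nat.cast_ne_zero (R := ℂ).2 (Nat.factorial_ne_zero i)
      have h4 := Nat.cast_ne_zero (R := ℂ).2 (Nat.factorial_ne_zero (n - i))
      field_simp
    · rw [posPaths_eq_empty h2]
      simp
  rw [Finset.sum_congr rfl hsplit, Finset.sum_comm]
  refine Finset.sum_congr rfl fun κ hκ => ?_
  obtain ⟨hκ', hκN⟩ := D.mem_pts.1 hκ
  by_cases hlt : pairZ D.ell κ < pairZ D.ell σ
  · rw [hv0 σ hσ κ hκ' hlt.le, if_neg (by rintro rfl; omega)]
    simp
  obtain ⟨j, hj⟩ := Int.eq_ofNat_of_zero_le (sub_nonneg.2 (not_lt.1 hlt))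
  rw [Finset.sum_eq_single_of_mem j (Finset.mem_range.2 (by omega))
    fun i _ hi => if_neg (by omega), if_pos (by omega)]
  congr 3
  omega

lemma sum_neg_one_pow_div_factorial (n : ℕ) :
    ∑ i ∈ Finset.range (n + 1),
      ((-1 : ℂ) ^ (n - i) / ((Nat.factorial i : ℂ) * (Nat.factorial (n - i) : ℂ))) =
        if n = 0 then 1 else 0 := by
  have h0 := Nat.cast_ne_zero (R := ℂ).2 (Nat.factorial_ne_zero n)
  have h1 := add_pow (1 : ℂ) (-1) n
  have h2 : ∑ i ∈ Finset.range (n + 1),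
      ((-1 : ℂ) ^ (n - i) / ((Nat.factorial i : ℂ) * (Nat.factorial (n - i) : ℂ))) =
        (1 + -1) ^ n / n.factorial := by
    rw [h1, Finset.sum_div]
    refine Finset.sum_congr rfl fun i hi => ?_
    rw [Nat.cast_choose ℂ (Nat.lt_succ_iff.1 (Finset.mem_range.1 hi)), one_pow]
    have h3 := Nat.cast_ne_zero (R := ℂ).2 (Nat.factorial_ne_zero i)
    have h4 := Nat.cast_ne_zero (R := ℂ).2 (Nat.factorial_ne_zero (n - i))
    field_simp
  rw [h2]
  by_cases hn : n = 0
  · subst hn; simp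
  · simp [hn]

/-- The inverse of the triangular matrix `v`. -/
lemma sum_inverse (hF : ∀ ν ∈ LamPlus, ∀ η ∈ D.Λ₁, ν - η ∉ LamPlus → F η ν = 0)
    (hv0 : ∀ κ ∈ LamPlus, ∀ ν ∈ LamPlus, pairZ D.ell ν ≤ pairZ D.ell κ →
      v κ ν = if ν = κ then 1 else 0)
    (hvr : ∀ κ ∈ LamPlus, ∀ ν ∈ LamPlus, ((pairZ D.ell ν : ℂ) - pairZ D.ell κ) * v κ ν =
      ∑ η ∈ D.Λ₁, F η ν * v κ (ν - η))
    {σ ν : ι → ℤ} (hσ : σ ∈ LamPlus) (hν : ν ∈ LamPlus) {N : ℕ} (hN : pairZ D.ell ν = N) :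
    ∑ κ ∈ D.pts N, (-1 : ℂ) ^ (pairZ D.ell ν - pairZ D.ell κ).toNat * v σ κ * v κ ν =
      if σ = ν then 1 else 0 := by
  by_cases hlt : pairZ D.ell ν < pairZ D.ell σ
  · rw [if_neg (by rintro rfl; omega)]
    refine Finset.sum_eq_zero fun κ hκ => ?_
    obtain ⟨h1, h2⟩ := D.mem_pts.1 hκ
    rw [hv0 σ hσ κ h1 (by omega), if_neg (by rintro rfl; omega)]
    simp
  obtain ⟨n, hn⟩ := Int.eq_ofNat_of_zero_le (sub_nonneg.2 (not_lt.1 hlt))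
  have hn' : pairZ D.ell ν = pairZ D.ell σ + n := by omega
  have h1 := sum_alternating hF hv0 hvr hσ hν hn' hN fun _ => 1
  simp only [one_mul, mul_one, ← Finset.mul_sum, sum_neg_one_pow_div_factorial] at h1
  rw [← h1]
  by_cases h0 : n = 0
  · subst h0
    rw [if_pos rfl, one_mul, sum_pathWeight_zero F hν]
  · rw [if_neg h0, zero_mul, if_neg (by rintro rfl; omega)]

end Inversion

/-- Theorem 3.2, path formula for Pieri coefficients: assuming
axiom C0, for regular dominant `ρ ∈ V₀`, `h ∈ P^W`, `τ ∈ Λ` with `d = ℓ(τ)`,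
and `μ ∈ Λ₊` with `μ+τ ∈ Λ₊`,
`a_τ^h(μ) = Σ_{τ*}[Σ_{i=0}^d ((-1)^{d-i}/(i!(d-i)!))·h(ρ+τ_i)]·
f_{τ₁-τ₀}(ρ+τ₁)⋯f_{τ_d-τ_{d-1}}(ρ+τ_d)`, the outer sum over all positive
paths from `μ` to `μ+τ`. -/
theorem statement11 (D : Data ι) (hC0 : D.C0)
    (ρ : ι → ℂ) (hρ : D.InV0 ρ) (hreg : D.Regular ρ) (hdom : D.Dominant ρ)
    (k : (ι → ℤ) → ℂ) (hk : D.IsK ρ k)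
    (pl : (ι → ℤ) → MvPolynomial ι ℂ)
    (hpl : ∀ lam : ι → ℤ, lam ∈ LamPlus → D.CapelliAt ρ lam (pl lam))
    (h : MvPolynomial ι ℂ) (hh : D.WInv h)
    (τ : ι → ℤ) (hτ : τ ∈ D.Lam) (d : ℕ) (hd : pairZ D.ell τ = (d : ℤ))
    (μ : ι → ℤ) (hμ : μ ∈ LamPlus) (hμτ : μ + τ ∈ LamPlus)
    (a : (ι → ℤ) → ℂ) (hafin : (Function.support a).Finite)
    (ha0 : ∀ η : ι → ℤ, μ + η ∉ LamPlus → a η = 0)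
    (haexp : ∀ z : ι → ℂ,
      eval z h * eval z (pl μ) = ∑ᶠ η : ι → ℤ, a η * eval z (pl (μ + η))) :
    a τ = ∑ s ∈ posPaths D μ (μ + τ) d,
      (∑ i ∈ Finset.range (d + 1),
        ((-1 : ℂ) ^ (d - i) / ((Nat.factorial i : ℂ) * (Nat.factorial (d - i) : ℂ))) *
          eval (ρ + toV (pathPt μ s i)) h) *
      ∏ i : Fin d, D.f k (s i) (ρ + toV (pathPt μ s ((i : ℕ) + 1))) := by
  set F : (ι → ℤ) → (ι → ℤ) → ℂ := fun η ν => D.f k η (ρ + toV ν) with hFdef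
  set v : (ι → ℤ) → (ι → ℤ) → ℂ := fun κ ν => eval (ρ + toV ν) (pl κ) with hvdef
  have hF : ∀ ν ∈ LamPlus, ∀ η ∈ D.Λ₁, ν - η ∉ LamPlus → F η ν = 0 :=
    fun ν hν η hη h => D.f_eq_zero hk hη hν h
  have hv0 : ∀ κ ∈ LamPlus, ∀ ν ∈ LamPlus, pairZ D.ell ν ≤ pairZ D.ell κ →
      v κ ν = if ν = κ then 1 else 0 := fun κ hκ ν hν h => (hpl κ hκ).2.2 ν hν h
  have hvr : ∀ κ ∈ LamPlus, ∀ ν ∈ LamPlus, ((pairZ D.ell ν : ℂ) - pairZ D.ell κ) * v κ ν =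
      ∑ η ∈ D.Λ₁, F η ν * v κ (ν - η) := fun κ hκ ν hν =>
    Data.capelli_recurrence hC0 hreg hdom hk hpl hκ hν
  obtain ⟨N, hN⟩ := Int.eq_ofNat_of_zero_le (D.pairZ_ell_nonneg hμτ)
  have h1 := sum_alternating hF hv0 hvr hμ hμτ (n := d) (by rw [pairZ_add_right, hd]) hN
    fun κ => eval (ρ + toV κ) h
  have hexp : ∀ κ, eval (ρ + toV κ) h * v μ κ = ∑ η ∈ hafin.toFinset, a η * v (μ + η) κ :=
    fun κ => by
      rw [hvdef, haexp]
      refine finsum_eq_sum_of_support_subset _ fun η hη => ?_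
      rw [Set.Finite.coe_toFinset]
      exact left_ne_zero_of_mul hη
  refine Eq.trans ?_ h1.symm
  simp only [hexp, Finset.mul_sum, Finset.sum_mul]
  rw [Finset.sum_comm]
  have hinv : ∀ η ∈ hafin.toFinset,
      ∑ κ ∈ D.pts N, (-1 : ℂ) ^ (pairZ D.ell (μ + τ) - pairZ D.ell κ).toNat *
        (a η * v (μ + η) κ) * v κ (μ + τ) = if η = τ then a η else 0 := fun η hη => by
    have hmem : μ + η ∈ LamPlus := by
      by_contra h0
      exact (Set.Finite.mem_toFinset hafin).1 hη (ha0 η h0)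
    have h2 := sum_inverse hF hv0 hvr hmem hμτ hN
    simp only [add_right_inj] at h2
    rw [← mul_one (a η), ← mul_zero (a η), ← mul_ite, ← h2, Finset.mul_sum]
    refine Finset.sum_congr rfl fun κ _ => by ring
  rw [Finset.sum_congr rfl hinv, Finset.sum_ite_eq']
  split_ifs with h3
  · rfl
  · by_contra h4
    exact h3 ((Set.Finite.mem_toFinset hafin).2 h4)

end Knop

end
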